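/- arXiv:1804.11015 — 2 statements merged into one kernel-verified Lean document; each statement's English description precedes it below -/
import Mathlib

section
/- Let X ⊂ P^r_{F_q} be a smooth quasi-projective subscheme of dimension n ≥ 0 over a finite field F_q, and fix an integer k with 1 ≤ k ≤ n−1. If q ≥ 3, then ζ_X(n+1/2)^{−1} ≤ ∏_{x closed point of X} (1 − q^{−k·deg(x)} + q^{−k·deg(x)}·L(q^{deg(x)}, n, k)). If q = 2, then 2^{−#X(F_2)}·ζ_X(n+1/2)^{−1} ≤ ∏_{x closed point of X} (1 − q^{−k·deg(x)} + q^{−k·deg(x)}·L(q^{deg(x)}, n, k)). -/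
open MvPolynomial

attribute [local instance] MvPolynomial.gradedAlgebra

noncomputable section

namespace EffectiveBertini

variable (q : ℕ) (Fq : Type) [Field Fq] [Fintype Fq] (r : ℕ)

/-- A fixed algebraic closure of the finite field `Fq`. -/
abbrev Kbar (Fq : Type) [Field Fq] : Type := AlgebraicClosure Fq

/-- The homogeneous coordinate ring `F_q[x_0, …, x_r]` of `ℙ^r`. -/
abbrev PolyRing (Fq : Type) [Field Fq] (r : ℕ) : Type := MvPolynomial (Fin (r + 1)) Fq

/-- Extension of an ideal of `F_q[x_0, …, x_r]` to the polynomial ring over the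
algebraic closure. -/
def idealBC (I : Ideal (PolyRing Fq r)) : Ideal (PolyRing (Kbar Fq) r) :=
  I.map (MvPolynomial.map (algebraMap Fq (Kbar Fq)))

/-- The set of points of `ℙ^r(K̄)` at which every polynomial of (the extension of) `I`
vanishes; for homogeneous `I` this is the set of `K̄`-points of the closed subscheme
`V(I) ⊆ ℙ^r`. -/
def zeroSet (I : Ideal (PolyRing Fq r)) :
    Set (Projectivization (Kbar Fq) (Fin (r + 1) → Kbar Fq)) :=
  {P | ∀ f ∈ idealBC Fq r I, MvPolynomial.eval P.rep f = 0}

/-- The `q`-power Frobenius acting on the points of `ℙ^r(K̄)`. -/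
def frobP (P : Projectivization (Kbar Fq) (Fin (r + 1) → Kbar Fq)) :
    Projectivization (Kbar Fq) (Fin (r + 1) → Kbar Fq) :=
  Projectivization.mk (Kbar Fq) (fun i => P.rep i ^ q) (by
    obtain ⟨i, hi⟩ := Function.ne_iff.mp P.rep_nonzero
    exact Function.ne_iff.mpr ⟨i, by simpa using pow_ne_zero q hi⟩)

/-- Two `K̄`-points of a subset `X ⊆ ℙ^r(K̄)` are identified iff one is obtained from the
other by the Frobenius; the quotient by (the equivalence relation generated by) this
relation is the set of closed points of `X`. -/
def frobRel (X : Set (Projectivization (Kbar Fq) (Fin (r + 1) → Kbar Fq))) :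
    X → X → Prop :=
  fun P P' => frobP q Fq r P.1 = P'.1

/-- The set of closed points of `X`: Frobenius orbits of `K̄`-points. -/
def ClosedPoint (X : Set (Projectivization (Kbar Fq) (Fin (r + 1) → Kbar Fq))) : Type :=
  Quot (frobRel q Fq r X)

/-- The degree of a closed point: the size of the corresponding Frobenius orbit,
i.e. the degree of its residue field over `F_q`. -/
def cpDegree {X : Set (Projectivization (Kbar Fq) (Fin (r + 1) → Kbar Fq))}
    (c : ClosedPoint q Fq r X) : ℕ :=
  Nat.card {P : X // Quot.mk (frobRel q Fq r X) P = c}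

/-- The zeta function of `X`, `ζ_X(s) = ∏_{x closed point of X} (1 − q^{−s·deg x})⁻¹`. -/
def zetaValue (X : Set (Projectivization (Kbar Fq) (Fin (r + 1) → Kbar Fq)))
    (s : ℝ) : ℝ :=
  ∏' c : ClosedPoint q Fq r X, (1 - (q : ℝ) ^ (-(s * (cpDegree q Fq r c : ℝ))))⁻¹

/-- The number of `F_q`-rational points of `X`: fixed points of the Frobenius. -/
def rationalPointCount (X : Set (Projectivization (Kbar Fq) (Fin (r + 1) → Kbar Fq))) : ℕ :=
  Nat.card {P : X // frobP q Fq r P.1 = P.1}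

/-- The gradient vector `(∂f/∂x_i(v))_i` of a polynomial at a point `v` of the cone. -/
def gradientAt (v : Fin (r + 1) → Kbar Fq) (f : PolyRing (Kbar Fq) r) :
    Fin (r + 1) → Kbar Fq :=
  fun i => MvPolynomial.eval v (MvPolynomial.pderiv i f)

/-- Jacobian criterion: the locally closed subscheme `X = V(I) ∖ V(J)` of `ℙ^r` is smooth of
dimension `n` iff at (a representative of) each point of `X` the space spanned by the
gradients of the elements of `I` has rank `r − n`. -/
def SmoothOfDim (I J : Ideal (PolyRing Fq r)) (n : ℕ) : Prop :=
  ∀ P ∈ zeroSet Fq r I \ zeroSet Fq r J,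
    Module.finrank (Kbar Fq)
      (Submodule.span (Kbar Fq)
        (gradientAt Fq r (Projectivization.rep P) '' (idealBC Fq r I : Set (PolyRing (Kbar Fq) r))))
      = r - n

/-- The Hilbert function `d ↦ dim_{F_q} (F_q[x_0,…,x_r]/I)_d`. -/
def hilbF (I : Ideal (PolyRing Fq r)) (d : ℕ) : ℕ :=
  Module.finrank Fq
    ((MvPolynomial.homogeneousSubmodule (Fin (r + 1)) Fq d).map
      (Ideal.Quotient.mkₐ Fq I).toLinearMap)

/-- `V(I) ⊆ ℙ^r` has dimension `n` and degree `D`: its Hilbert polynomial has degree at most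
`n` and its coefficient in degree `n` is `D/n!`. -/
def HasDimDeg (I : Ideal (PolyRing Fq r)) (n D : ℕ) : Prop :=
  ∃ P : Polynomial ℚ,
    (∀ᶠ d : ℕ in Filter.atTop, (hilbF Fq r I d : ℚ) = P.eval (d : ℚ)) ∧
    P.natDegree ≤ n ∧ P.coeff n = (D : ℚ) / (n.factorial : ℚ)

/-- `V(I) ⊆ ℙ^r_{F_q}` is geometrically connected: its zero locus in the projective
spectrum over the algebraic closure is connected. -/
def GeomConnected (I : Ideal (PolyRing Fq r)) : Prop :=
  IsConnected (ProjectiveSpectrum.zeroLocus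
    (MvPolynomial.homogeneousSubmodule (Fin (r + 1)) (Kbar Fq))
    ((idealBC Fq r I : Ideal (PolyRing (Kbar Fq) r)) : Set (PolyRing (Kbar Fq) r)))

end EffectiveBertini

open EffectiveBertini Filter

/-- `L(q, n, k) = ∏_{j=0}^{k−1} (1 − q^{−(n−j)})`, the probability that `k` uniformly chosen
vectors of `F_q^n` are linearly independent (defined for a real base `q`). -/
def LinIndepProb (q : ℝ) (n k : ℕ) : ℝ :=
  ∏ j ∈ Finset.range k, (1 - q ^ (-((n : ℝ) - (j : ℝ))))

/-- An integral extension of rings has at least the Krull dimension of its base. -/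
theorem ringKrullDim_le_of_isIntegral_of_injective {R S : Type*} [CommRing R] [CommRing S]
    {f : R →+* S} (hf : f.IsIntegral) (hinj : Function.Injective f) :
    ringKrullDim R ≤ ringKrullDim S := by
  algebraize [f]
  have : FaithfulSMul R S := (faithfulSMul_iff_algebraMap_injective R S).mpr hinj
  refine iSup_le fun l => ?_
  obtain ⟨P, hP⟩ := Algebra.IsIntegral.comap_surjective R S l.head
  have : P.asIdeal.LiesOver l.head.asIdeal := ⟨by rw [← hP]; rfl⟩
  obtain ⟨L, hL, -⟩ := Ideal.exists_ltSeries_of_hasGoingUp (S := S) l P.asIdeal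
  exact Order.le_krullDim_iff.mpr ⟨L, hL⟩

/-- Noether normalization of `k[x] / I` with at most `dim` parameters. -/
theorem exists_integral_algHom_of_ringKrullDim_le {k A : Type*} [Field k] [CommRing A]
    [Nontrivial A] [Algebra k A] [Algebra.FiniteType k A] {m : ℕ} (hdim : ringKrullDim A ≤ m) :
    ∃ s ≤ m, ∃ g : MvPolynomial (Fin s) k →ₐ[k] A, g.toRingHom.IsIntegral := by
  obtain ⟨s, g, hinj, hint⟩ := exists_integral_inj_algHom_of_fg k A
  refine ⟨s, ?_, g, hint⟩
  have h := (ringKrullDim_le_of_isIntegral_of_injective hint hinj).trans hdim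
  rw [MvPolynomial.ringKrullDim_of_isNoetherianRing, ringKrullDim_eq_zero_of_field] at h
  simpa using h

section ConePoints

variable {F K σ : Type*} [Field F] [Fintype F] [Field K] [Algebra F K]

theorem aeval_pow_card_pow (v : σ → K) (d : ℕ) (f : MvPolynomial σ F) :
    aeval (fun i => v i ^ Fintype.card F ^ d) f = aeval v f ^ Fintype.card F ^ d := by
  induction d with
  | zero => simp
  | succ d ih =>
    have h := DFunLike.congr_fun (MvPolynomial.comp_aeval
      (fun i => v i ^ Fintype.card F ^ d) (FiniteField.frobeniusAlgHom F K)) f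
    simp only [AlgHom.comp_apply, FiniteField.coe_frobeniusAlgHom, ← pow_mul, ← pow_succ] at h
    rw [← h, ih, ← pow_mul, pow_succ]

/-- Points of the affine scheme `V(I)` with coordinates fixed by the `d`-th power of Frobenius. -/
def conePoints (K : Type*) [Field K] [Algebra F K] (I : Ideal (MvPolynomial σ F)) (d : ℕ) :
    Set (σ → K) :=
  {v | (∀ i, v i ^ Fintype.card F ^ d = v i) ∧ ∀ f ∈ I, aeval v f = 0}

open Polynomial in
theorem mem_roots_X_pow_sub_X {Q : ℕ} (hQ : 1 < Q) (x : K) :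
    x ∈ (Polynomial.X ^ Q - Polynomial.X : K[X]).roots ↔ x ^ Q = x := by
  rw [mem_roots (FiniteField.X_pow_card_sub_X_ne_zero K hQ)]
  simp [sub_eq_zero]

open Polynomial in
/-- A scheme of dimension at most `m` has `O(Q ^ m)` points over the field with `Q` elements. -/
theorem exists_ncard_conePoints_le [Finite σ] (I : Ideal (MvPolynomial σ F)) {m : ℕ}
    (hdim : ringKrullDim (MvPolynomial σ F ⧸ I) ≤ m) :
    ∃ C : ℕ, ∀ d, 1 ≤ d → (conePoints K I d).Finite ∧
      (conePoints K I d).ncard ≤ C * (Fintype.card F ^ d) ^ m := by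
  classical
  have := Fintype.ofFinite σ
  have hq : 1 < Fintype.card F := Fintype.one_lt_card
  by_cases hI : I = ⊤
  · refine ⟨0, fun d _ => ?_⟩
    have : conePoints K I d = ∅ := by
      refine Set.eq_empty_of_forall_notMem fun v hv => ?_
      simpa using hv.2 1 (by simp [hI])
    simp [this]
  have : Nontrivial (MvPolynomial σ F ⧸ I) := Ideal.Quotient.nontrivial_iff.mpr hI
  obtain ⟨s, hs, g, hg⟩ := exists_integral_algHom_of_ringKrullDim_le (k := F) hdim
  choose p hpm hp using fun i => hg (Ideal.Quotient.mk I (MvPolynomial.X i))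
  refine ⟨∏ i, (p i).natDegree, fun d hd => ?_⟩
  have hQ : 1 < Fintype.card F ^ d := Nat.one_lt_pow (by lia) hq
  set fixed : Finset K :=
    (Polynomial.X ^ (Fintype.card F ^ d) - Polynomial.X : K[X]).roots.toFinset with hfixed
  have hfixed_card : fixed.card ≤ Fintype.card F ^ d :=
    (Multiset.toFinset_card_le _).trans ((card_roots' _).trans
      (FiniteField.X_pow_card_sub_X_natDegree_eq K hQ).le)
  let fiber (t : Fin s → K) : Finset (σ → K) :=
    Fintype.piFinset fun i =>
      ((p i).map (MvPolynomial.aeval t : _ →ₐ[F] K).toRingHom).roots.toFinset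
  let cover : Finset (σ → K) := (Fintype.piFinset fun _ : Fin s => fixed).biUnion fiber
  have hsub : conePoints K I d ⊆ cover := by
    rintro v ⟨hv, hvI⟩
    let φ : (MvPolynomial σ F ⧸ I) →ₐ[F] K := Ideal.Quotient.liftₐ I (MvPolynomial.aeval v) hvI
    have hφ (f) : φ (Ideal.Quotient.mk I f) = MvPolynomial.aeval v f := rfl
    have hcomp : (MvPolynomial.aeval fun j => φ (g (MvPolynomial.X j))) = φ.comp g :=
      MvPolynomial.algHom_ext (by simp)
    simp only [cover, Finset.coe_biUnion, Set.mem_iUnion, Finset.mem_coe, Fintype.mem_piFinset,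
      fiber, Multiset.mem_toFinset, hfixed]
    refine ⟨fun j => φ (g (MvPolynomial.X j)), fun j => ?_, fun i => ?_⟩
    · rw [mem_roots_X_pow_sub_X hQ]
      beta_reduce
      obtain ⟨f, hf⟩ := Ideal.Quotient.mk_surjective (g (MvPolynomial.X j))
      rw [← hf, hφ, ← aeval_pow_card_pow]
      simp [hv]
    · rw [mem_roots ((hpm i).map _).ne_zero, IsRoot.def, Polynomial.eval_map, hcomp]
      have h := congrArg φ (hp i)
      have h2 := hom_eval₂ (p i) g.toRingHom φ.toRingHom (Ideal.Quotient.mk I (MvPolynomial.X i))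
      have h3 : φ (Ideal.Quotient.mk I (MvPolynomial.X i)) = v i := by simp [hφ]
      rw [← h3]
      refine h2.symm.trans ?_
      exact h.trans (map_zero φ)
  have hcover : cover.card ≤ (∏ i, (p i).natDegree) * (Fintype.card F ^ d) ^ m := by
    calc cover.card ≤ (Fintype.piFinset fun _ : Fin s => fixed).card * ∏ i, (p i).natDegree := by
          refine Finset.card_biUnion_le_card_mul _ _ _ fun t _ => ?_
          rw [Fintype.card_piFinset]
          refine Finset.prod_le_prod' fun i _ => ?_
          exact (Multiset.toFinset_card_le _).trans ((card_roots' _).trans natDegree_map_le)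
      _ = (∏ i, (p i).natDegree) * fixed.card ^ s := by
          rw [Fintype.card_piFinset_const, mul_comm]
      _ ≤ _ := by
          refine Nat.mul_le_mul_left _ ?_
          exact (Nat.pow_le_pow_left hfixed_card s).trans (Nat.pow_le_pow_right (by lia) hs)
  refine ⟨cover.finite_toSet.subset hsub, ?_⟩
  exact (Set.ncard_le_ncard hsub cover.finite_toSet).trans ((Set.ncard_coe_finset _).le.trans hcover)

open Polynomial in
/-- Over an algebraically closed field, the fixed points of `x ↦ x ^ Q` form a field of `Q`
elements. -/
theorem ncard_fixed_pow [IsAlgClosed K] {d : ℕ} (hd : 1 ≤ d) :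
    {x : K | x ^ Fintype.card F ^ d = x}.ncard = Fintype.card F ^ d := by
  classical
  obtain ⟨p, _, _, hp, card_eq⟩ := FiniteField.card' F
  have : CharP K p := charP_of_injective_algebraMap' F p
  have hQ : 1 < Fintype.card F ^ d := Nat.one_lt_pow (by lia) Fintype.one_lt_card
  have hsep : (Polynomial.X ^ (Fintype.card F ^ d) - Polynomial.X : K[X]).Separable :=
    galois_poly_separable p _ (by
      rw [card_eq, ← pow_mul]; exact dvd_pow_self p (by positivity))
  have hset : {x : K | x ^ Fintype.card F ^ d = x} =
      (Polynomial.X ^ (Fintype.card F ^ d) - Polynomial.X : K[X]).roots.toFinset := by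
    ext x; simp [mem_roots_X_pow_sub_X hQ, -mem_roots']
  rw [hset, Set.ncard_coe_finset, Multiset.toFinset_card_of_nodup (nodup_roots hsep),
    ← (IsAlgClosed.splits _).natDegree_eq_card_roots,
    FiniteField.X_pow_card_sub_X_natDegree_eq K hQ]

end ConePoints

theorem aeval_smul_of_isHomogeneous {F K σ : Type*} [CommSemiring F] [CommSemiring K] [Algebra F K]
    {f : MvPolynomial σ F} {m : ℕ} (hf : f.IsHomogeneous m) (a : K) (v : σ → K) :
    aeval (a • v) f = a ^ m * aeval v f := by
  rw [aeval_def, aeval_def, eval₂_eq, eval₂_eq, Finset.mul_sum]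
  refine Finset.sum_congr rfl fun d hd => ?_
  have hdeg : ∑ i ∈ d.support, d i = m := by
    rw [← hf (mem_support_iff.mp hd), Finsupp.weight_apply]
    simp [Finsupp.sum]
  simp only [Pi.smul_apply, smul_eq_mul, mul_pow, Finset.prod_mul_distrib,
    Finset.prod_pow_eq_pow_sum, hdeg]
  ring

theorem aeval_smul_eq_zero {F K σ : Type*} [Field F] [Field K] [Algebra F K]
    {I : Ideal (MvPolynomial σ F)} (hI : I.IsHomogeneous (homogeneousSubmodule σ F))
    {v : σ → K} (hv : ∀ f ∈ I, aeval v f = 0) (a : K) : ∀ f ∈ I, aeval (a • v) f = 0 := by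
  intro f hf
  rw [← sum_homogeneousComponent f, map_sum]
  refine Finset.sum_eq_zero fun i _ => ?_
  have hmem : homogeneousComponent i f ∈ I := by
    have h := hI i hf
    rwa [DirectSum.decompose, Equiv.coe_fn_mk, decomposition.decompose'_apply] at h
  rw [aeval_smul_of_isHomogeneous (homogeneousComponent_isHomogeneous i f), hv _ hmem, mul_zero]

namespace EffectiveBertini

open Projectivization
open scoped LinearAlgebra.Projectivization

variable {Fq : Type} [Field Fq] {r : ℕ}

theorem mem_zeroSet_mk {I : Ideal (PolyRing Fq r)}
    (hI : I.IsHomogeneous (homogeneousSubmodule (Fin (r + 1)) Fq))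
    {v : Fin (r + 1) → Kbar Fq} (hv : v ≠ 0) :
    mk (Kbar Fq) v hv ∈ zeroSet Fq r I ↔ ∀ f ∈ I, aeval v f = 0 := by
  have hrep (w : Fin (r + 1) → Kbar Fq) :
      (∀ f ∈ idealBC Fq r I, eval w f = 0) ↔ ∀ f ∈ I, aeval w f = 0 := by
    have h := Ideal.map_le_iff_le_comap (f := map (σ := Fin (r + 1)) (algebraMap Fq (Kbar Fq)))
      (I := I) (K := RingHom.ker (eval w))
    simpa [SetLike.le_def, RingHom.mem_ker, eval_map, aeval_def, idealBC] using h
  obtain ⟨a, ha⟩ := exists_smul_eq_mk_rep (Kbar Fq) v hv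
  refine (hrep _).trans ⟨fun h => ?_, fun h => ?_⟩
  · have := aeval_smul_eq_zero hI h (a⁻¹ : (Kbar Fq)ˣ)
    rwa [← ha, Units.smul_def, smul_smul, Units.inv_mul, one_smul] at this
  · rw [← ha]
    exact aeval_smul_eq_zero hI h _

theorem pow_ne_zero_of_ne_zero {v : Fin (r + 1) → Kbar Fq} (hv : v ≠ 0) (m : ℕ) :
    (fun i => v i ^ m) ≠ 0 := by
  obtain ⟨i, hi⟩ := Function.ne_iff.mp hv
  exact Function.ne_iff.mpr ⟨i, by simpa using pow_ne_zero m hi⟩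

theorem frobP_mk (q : ℕ) {v : Fin (r + 1) → Kbar Fq} (hv : v ≠ 0) :
    frobP q Fq r (mk (Kbar Fq) v hv) =
      mk (Kbar Fq) (fun i => v i ^ q) (pow_ne_zero_of_ne_zero hv q) := by
  obtain ⟨a, ha⟩ := exists_smul_eq_mk_rep (Kbar Fq) v hv
  rw [frobP, mk_eq_mk_iff']
  refine ⟨(a : Kbar Fq) ^ q, funext fun i => ?_⟩
  simp [← ha, Units.smul_def, mul_pow]

theorem frobP_iterate_mk (q d : ℕ) {v : Fin (r + 1) → Kbar Fq} (hv : v ≠ 0) :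
    (frobP q Fq r)^[d] (mk (Kbar Fq) v hv) =
      mk (Kbar Fq) (fun i => v i ^ q ^ d) (pow_ne_zero_of_ne_zero hv _) := by
  induction d with
  | zero => simp
  | succ d ih =>
    rw [Function.iterate_succ_apply', ih, frobP_mk]
    simp only [← pow_mul, ← pow_succ]

theorem exists_mk_eq_of_iterate_frobP_eq (P : ℙ (Kbar Fq) (Fin (r + 1) → Kbar Fq)) :
    ∃ (w : Fin (r + 1) → Kbar Fq) (hw : w ≠ 0), mk (Kbar Fq) w hw = P ∧
      ∀ q d, (frobP q Fq r)^[d] P = P → ∀ i, w i ^ q ^ d = w i := by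
  obtain ⟨i, hi⟩ := Function.ne_iff.mp P.rep_nonzero
  have hi : P.rep i ≠ 0 := hi
  have hw : (P.rep i)⁻¹ • P.rep ≠ 0 := smul_ne_zero (inv_ne_zero hi) P.rep_nonzero
  have hmk : mk (Kbar Fq) ((P.rep i)⁻¹ • P.rep) hw = P := by
    conv_rhs => rw [← mk_rep P]
    rw [mk_eq_mk_iff']
    exact ⟨_, rfl⟩
  refine ⟨_, hw, hmk, fun q d h j => ?_⟩
  have hfix : (frobP q Fq r)^[d] (mk (Kbar Fq) _ hw) = mk (Kbar Fq) _ hw := by rw [hmk, h]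
  rw [frobP_iterate_mk, mk_eq_mk_iff'] at hfix
  obtain ⟨a, ha⟩ := hfix
  have ha1 : a = 1 := by
    have := congrFun ha i
    simpa [hi] using this
  rw [ha1, one_smul] at ha
  exact (congrFun ha j).symm

variable [Fintype Fq]

theorem frobP_mem_zeroSet_iff {I : Ideal (PolyRing Fq r)}
    (hI : I.IsHomogeneous (homogeneousSubmodule (Fin (r + 1)) Fq))
    (P : ℙ (Kbar Fq) (Fin (r + 1) → Kbar Fq)) :
    frobP (Fintype.card Fq) Fq r P ∈ zeroSet Fq r I ↔ P ∈ zeroSet Fq r I := by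
  induction P using Projectivization.ind with
  | h v hv =>
    rw [frobP_mk, mem_zeroSet_mk hI, mem_zeroSet_mk hI]
    have h := aeval_pow_card_pow v 1 (F := Fq)
    simp only [pow_one] at h
    simp [h]

theorem exists_iterate_frobP_eq (P : ℙ (Kbar Fq) (Fin (r + 1) → Kbar Fq)) :
    ∃ m, 0 < m ∧ (frobP (Fintype.card Fq) Fq r)^[m] P = P := by
  induction P using Projectivization.ind with
  | h v hv =>
    let L := IntermediateField.adjoin Fq (Set.range v)
    have : FiniteDimensional Fq L := IntermediateField.finiteDimensional_adjoin fun x _ =>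
      (Algebra.IsAlgebraic.isAlgebraic x).isIntegral
    have : Finite L := Module.finite_of_finite Fq
    have := Fintype.ofFinite L
    refine ⟨Module.finrank Fq L, Module.finrank_pos, ?_⟩
    rw [frobP_iterate_mk]
    congr 1
    funext i
    rw [← Module.card_eq_pow_finrank (K := Fq) (V := L)]
    exact congrArg Subtype.val (FiniteField.pow_card
      (⟨v i, IntermediateField.subset_adjoin _ _ ⟨i, rfl⟩⟩ : L))

variable {X : Set (ℙ (Kbar Fq) (Fin (r + 1) → Kbar Fq))}

open Function in
/-- A closed point of degree `d` consists of points fixed by the `d`-th power of Frobenius. -/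
theorem iterate_cpDegree_out (hX : Set.MapsTo (frobP (Fintype.card Fq) Fq r) X X)
    (c : ClosedPoint (Fintype.card Fq) Fq r X) :
    1 ≤ cpDegree (Fintype.card Fq) Fq r c ∧
      (frobP (Fintype.card Fq) Fq r)^[cpDegree (Fintype.card Fq) Fq r c] (Quot.out c).1 =
        (Quot.out c).1 := by
  classical
  set φ : X → X := hX.restrict
  have hiter (m : ℕ) (P : X) : (φ^[m] P).1 = (frobP (Fintype.card Fq) Fq r)^[m] P.1 := by
    rw [hX.iterate_restrict]; rfl
  have hper (P : X) : P ∈ periodicPts φ := by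
    obtain ⟨m, hm, h⟩ := exists_iterate_frobP_eq P.1
    exact ⟨m, hm, Subtype.ext ((hiter m P).trans h)⟩
  set P := Quot.out c
  have hrel (Q Q' : X) : frobRel (Fintype.card Fq) Fq r X Q Q' ↔ φ Q = Q' :=
    (Subtype.ext_iff (a1 := φ Q) (a2 := Q')).symm
  have hfiber (Q : X) :
      Quot.mk (frobRel (Fintype.card Fq) Fq r X) Q = c ↔ Q ∈ periodicOrbit φ P := by
    rw [← Quot.out_eq c]
    constructor
    · intro h
      have horb := congrArg (Quot.lift (periodicOrbit φ) fun Q Q' hQ => by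
        rw [← (hrel Q Q').mp hQ, periodicOrbit_apply_eq (hper Q)]) h
      simp only at horb
      change _ = periodicOrbit φ P at horb
      rw [← horb]
      exact self_mem_periodicOrbit (hper Q)
    · rw [mem_periodicOrbit_iff (hper P)]
      rintro ⟨m, rfl⟩
      induction m with
      | zero => rfl
      | succ m ih =>
        rw [iterate_succ_apply', ← ih]
        exact (Quot.sound ((hrel _ _).mpr rfl)).symm
  have hcard : cpDegree (Fintype.card Fq) Fq r c = minimalPeriod φ P := by
    have : {Q : X | Quot.mk (frobRel (Fintype.card Fq) Fq r X) Q = c} =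
        (periodicOrbit φ P).toFinset := by
      ext Q
      simp only [Set.mem_ofPred_eq, hfiber]
      simp [periodicOrbit]
    rw [cpDegree, ← Set.coe_ofPred, this, Nat.card_coe_set_eq, Set.ncard_coe_finset,
      Cycle.toFinset, ← periodicOrbit_length]
    exact Multiset.toFinset_card_of_nodup nodup_periodicOrbit
  rw [hcard, ← hiter, iterate_minimalPeriod]
  exact ⟨minimalPeriod_pos_of_mem_periodicPts (hper P), rfl⟩

/-- A projective scheme of dimension at most `n` has `O(Q ^ n)` points over the field with `Q`
elements. -/
theorem exists_ncard_fixed_le {I : Ideal (PolyRing Fq r)} {n : ℕ}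
    (hI : I.IsHomogeneous (homogeneousSubmodule (Fin (r + 1)) Fq))
    (hdim : ringKrullDim (PolyRing Fq r ⧸ I) ≤ (n + 1 : ℕ)) :
    ∃ C : ℕ, ∀ d, 1 ≤ d →
      {P ∈ zeroSet Fq r I | (frobP (Fintype.card Fq) Fq r)^[d] P = P}.Finite ∧
      {P ∈ zeroSet Fq r I | (frobP (Fintype.card Fq) Fq r)^[d] P = P}.ncard ≤
        C * (Fintype.card Fq ^ d) ^ n := by
  obtain ⟨C, hC⟩ := exists_ncard_conePoints_le (K := Kbar Fq) I hdim
  refine ⟨2 * C, fun d hd => ?_⟩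
  obtain ⟨hfin, hle⟩ := hC d hd
  choose w hw hmk hfix using fun P => exists_mk_eq_of_iterate_frobP_eq (Fq := Fq) (r := r) P
  set Y := {P ∈ zeroSet Fq r I | (frobP (Fintype.card Fq) Fq r)^[d] P = P}
  set Q := Fintype.card Fq ^ d
  have hQ : 1 < Q := Nat.one_lt_pow (by lia) Fintype.one_lt_card
  set Λ : Set (Kbar Fq) := {x | x ^ Q = x} \ {0}
  have hΛ : Λ.ncard = Q - 1 := by
    rw [Set.ncard_sdiff_singleton_of_mem (by simp; lia), ncard_fixed_pow hd]
  have hmaps : ∀ x ∈ Y ×ˢ Λ, x.2 • w x.1 ∈ conePoints (Kbar Fq) I d := by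
    rintro ⟨P, a⟩ ⟨⟨hPI, hP⟩, ha, -⟩
    refine ⟨fun i => ?_, aeval_smul_eq_zero hI ?_ a⟩
    · have ha : a ^ Q = a := ha
      simp only [Pi.smul_apply, smul_eq_mul, mul_pow]
      rw [hfix P _ d hP, ha]
    · rwa [← mem_zeroSet_mk hI (hw P), hmk]
  have hinj : Set.InjOn (fun x : _ × Kbar Fq => x.2 • w x.1) (Y ×ˢ Λ) := by
    rintro ⟨P, a⟩ ⟨-, -, ha⟩ ⟨P', a'⟩ ⟨-, -, ha'⟩ h
    simp only [Set.mem_singleton_iff] at ha ha' h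
    have hPP : P = P' := by
      rw [← hmk P, ← hmk P', mk_eq_mk_iff']
      exact ⟨a⁻¹ * a', by rw [← smul_smul, ← h, smul_smul, inv_mul_cancel₀ ha, one_smul]⟩
    subst hPP
    rw [smul_left_injective _ (hw P) h]
  have h1 : (1 : Kbar Fq) ∈ Λ := by simp [Λ]
  have hYfin : Y.Finite :=
    ((Set.Finite.of_injOn hmaps hinj hfin).image Prod.fst).subset
      fun P hP => ⟨(P, 1), ⟨hP, h1⟩, rfl⟩
  refine ⟨hYfin, ?_⟩
  have hmul : Y.ncard * (Q - 1) ≤ C * Q ^ (n + 1) := by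
    rw [← hΛ, ← Set.ncard_prod]
    exact (Set.ncard_le_ncard_of_injOn _ hmaps hinj hfin).trans hle
  refine Nat.le_of_mul_le_mul_right (hmul.trans ?_) (show 0 < Q - 1 by lia)
  calc C * Q ^ (n + 1) = C * Q ^ n * Q := by ring
    _ ≤ C * Q ^ n * (2 * (Q - 1)) := Nat.mul_le_mul_left _ (by lia)
    _ = _ := by ring

theorem finite_cpDegree_eq_and_ncard_le {C n : ℕ}
    (hX : Set.MapsTo (frobP (Fintype.card Fq) Fq r) X X)
    (hC : ∀ d, 1 ≤ d → {P ∈ X | (frobP (Fintype.card Fq) Fq r)^[d] P = P}.Finite ∧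
      {P ∈ X | (frobP (Fintype.card Fq) Fq r)^[d] P = P}.ncard ≤ C * (Fintype.card Fq ^ d) ^ n)
    (d : ℕ) :
    {c : ClosedPoint (Fintype.card Fq) Fq r X | cpDegree _ Fq r c = d}.Finite ∧
    {c : ClosedPoint (Fintype.card Fq) Fq r X | cpDegree _ Fq r c = d}.ncard ≤
      {P ∈ X | (frobP (Fintype.card Fq) Fq r)^[d] P = P}.ncard ∧
    {c : ClosedPoint (Fintype.card Fq) Fq r X | cpDegree _ Fq r c = d}.ncard ≤
      C * (Fintype.card Fq ^ d) ^ n := by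
  have hmaps : ∀ c ∈ {c : ClosedPoint (Fintype.card Fq) Fq r X | cpDegree _ Fq r c = d},
      (Quot.out c).1 ∈ {P ∈ X | (frobP (Fintype.card Fq) Fq r)^[d] P = P} := by
    rintro c rfl
    exact ⟨(Quot.out c).2, (iterate_cpDegree_out hX c).2⟩
  have hinj : Function.Injective
      fun c : ClosedPoint (Fintype.card Fq) Fq r X => (Quot.out c).1 := fun c c' h => by
    rw [← Quot.out_eq c, ← Quot.out_eq c', Subtype.ext h]
  rcases Nat.eq_zero_or_pos d with rfl | hd
  · have : {c : ClosedPoint (Fintype.card Fq) Fq r X | cpDegree _ Fq r c = 0} = ∅ :=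
      Set.eq_empty_of_forall_notMem fun c hc => by
        have := (iterate_cpDegree_out hX c).1
        exact absurd hc (by simp; lia)
    simp [this]
  · have hle := Set.ncard_le_ncard_of_injOn _ hmaps hinj.injOn (hC d hd).1
    exact ⟨Set.Finite.of_injOn hmaps hinj.injOn (hC d hd).1, hle, hle.trans (hC d hd).2⟩

end EffectiveBertini

theorem summable_comp_of_ncard_fiber {ι : Type*} {deg : ι → ℕ} {g : ℕ → ℝ} (hg : ∀ d, 0 ≤ g d)
    (hfin : ∀ d, {i | deg i = d}.Finite)
    (hsum : Summable fun d => ({i | deg i = d}.ncard : ℝ) * g d) :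
    Summable fun i => g (deg i) := by
  rw [← (Equiv.sigmaFiberEquiv deg).summable_iff,
    summable_sigma_of_nonneg (f := (fun i => g (deg i)) ∘ Equiv.sigmaFiberEquiv deg) fun _ => hg _]
  have hval (d : ℕ) (i : {i // deg i = d}) :
      ((fun i => g (deg i)) ∘ Equiv.sigmaFiberEquiv deg) ⟨d, i⟩ = g d := by
    simp [Equiv.sigmaFiberEquiv, i.2]
  simp only [hval]
  have (d : ℕ) : Finite {i // deg i = d} := hfin d
  refine ⟨fun d => Summable.of_finite, hsum.congr fun d => ?_⟩
  rw [tsum_const, nsmul_eq_mul]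
  rfl

theorem pow_card_mul_inv_tprod_le_tprod {ι : Type*} {z e : ι → ℝ} (hz : Summable z)
    (hz0 : ∀ i, 0 ≤ z i) (hz1 : ∀ i, z i ≤ 1 / 2) (he0 : ∀ i, 0 ≤ e i) (he : ∀ i, e i ≤ 2 * z i)
    (S : Finset ι) (hS : ∀ i ∈ S, e i ≤ 1 / 2) (hS' : ∀ i ∉ S, e i ≤ z i) :
    (1 / 2 : ℝ) ^ S.card * (∏' i, (1 - z i)⁻¹)⁻¹ ≤ ∏' i, (1 - e i) := by
  classical
  have hzeta : Multipliable fun i => (1 - z i)⁻¹ := by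
    have h : Summable fun i => z i / (1 - z i) :=
      .of_nonneg_of_le (fun i => div_nonneg (hz0 i) (by linarith [hz1 i]))
        (fun i => by
          rw [div_le_iff₀ (by linarith [hz1 i])]
          nlinarith [hz0 i, hz1 i]) (hz.mul_left 2)
    refine (Real.multipliable_one_add_of_summable h).congr fun i => ?_
    have : 1 - z i ≠ 0 := by linarith [hz1 i]
    field_simp
    ring
  have heprod : Multipliable fun i => 1 - e i := by
    have h : Summable fun i => -e i := (Summable.of_nonneg_of_le he0 he (hz.mul_left 2)).neg
    simpa [sub_eq_add_neg] using Real.multipliable_one_add_of_summable h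
  have hpos : 1 ≤ ∏' i, (1 - z i)⁻¹ :=
    ge_of_tendsto hzeta.hasProd (.of_forall fun T => Finset.one_le_prod fun i _ =>
      one_le_inv_iff₀.mpr ⟨by linarith [hz1 i], by linarith [hz0 i]⟩)
  refine le_of_tendsto_of_tendsto ((hzeta.hasProd.inv₀ (by positivity)).const_mul _)
    heprod.hasProd ?_
  filter_upwards [eventually_ge_atTop S] with T hT
  have hsplit : (1 / 2 : ℝ) ^ S.card = ∏ i ∈ T, if i ∈ S then 1 / 2 else 1 := by
    rw [Finset.prod_ite_mem, Finset.inter_eq_right.mpr hT, Finset.prod_const]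
  rw [hsplit, ← Finset.prod_mul_distrib]
  refine Finset.prod_le_prod (fun i _ => ?_) fun i _ => ?_
  · have : 0 ≤ 1 - z i := by linarith [hz1 i]
    split_ifs <;> simpa
  · rw [inv_inv]
    split_ifs with h
    · linarith [hS i h, hz0 i, hz1 i]
    · linarith [hS' i h]

/-- The union bound for the probability that `k` random vectors are linearly dependent. -/
theorem one_sub_linIndepProb_bounds {Q : ℝ} (hQ : 1 < Q) {n k : ℕ} (hk : k ≤ n) :
    (0 ≤ LinIndepProb Q n k ∧ LinIndepProb Q n k ≤ 1) ∧
      1 - LinIndepProb Q n k ≤ Q⁻¹ ^ (n - k) * (Q⁻¹ / (1 - Q⁻¹)) := by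
  have hx0 : 0 < Q⁻¹ := by positivity
  have hx1 : Q⁻¹ < 1 := inv_lt_one_of_one_lt₀ hQ
  have hx : 0 < 1 - Q⁻¹ := by linarith
  induction k with
  | zero => simpa [LinIndepProb] using by positivity
  | succ k ih =>
    obtain ⟨⟨h0, h1⟩, h⟩ := ih (by lia)
    have hpow : Q ^ (-((n : ℝ) - k)) = Q⁻¹ ^ (n - k) := by
      rw [← Nat.cast_sub (by lia), Real.rpow_neg (by linarith), Real.rpow_natCast, inv_pow]
    have hy0 : 0 ≤ Q⁻¹ ^ (n - k) := by positivity
    have hy1 : Q⁻¹ ^ (n - k) ≤ 1 := pow_le_one₀ hx0.le hx1.le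
    have hsucc : LinIndepProb Q n (k + 1) = LinIndepProb Q n k * (1 - Q⁻¹ ^ (n - k)) := by
      rw [LinIndepProb, Finset.prod_range_succ, hpow, LinIndepProb]
    have hstep : Q⁻¹ ^ (n - (k + 1)) * (Q⁻¹ / (1 - Q⁻¹)) =
        Q⁻¹ ^ (n - k) * (Q⁻¹ / (1 - Q⁻¹)) + Q⁻¹ ^ (n - k) := by
      rw [show n - k = n - (k + 1) + 1 by lia, pow_succ]
      linear_combination Q⁻¹ ^ (n - (k + 1)) * div_mul_cancel₀ Q⁻¹ hx.ne'
    rw [hsucc, hstep]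
    exact ⟨⟨mul_nonneg h0 (by linarith), mul_le_one₀ h1 (by linarith) (by linarith)⟩,
      by nlinarith⟩

/-- Comparison of `1 - e`, the local factor of the Euler product, with the zeta factor `1 - z`. -/
theorem local_factor_bounds {Q : ℝ} (hQ : 2 ≤ Q) {n k : ℕ} (hk : k + 1 ≤ n) (hn : 2 ≤ n) :
    let e := Q⁻¹ ^ k * (1 - LinIndepProb Q n k)
    let z := Q⁻¹ ^ n * √Q⁻¹
    0 ≤ e ∧ e ≤ 1 / 2 ∧ e ≤ 2 * z ∧ 0 ≤ z ∧ z ≤ 1 / 2 ∧ (3 ≤ Q → e ≤ z) := by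
  intro e z
  obtain ⟨⟨-, hL1⟩, hL⟩ := one_sub_linIndepProb_bounds (by linarith : 1 < Q) (by lia : k ≤ n)
  have hx0 : 0 < Q⁻¹ := by positivity
  have hx2 : Q⁻¹ ≤ 1 / 2 := by rw [inv_le_comm₀ (by linarith) (by norm_num)]; linarith
  set t := √Q⁻¹
  have ht0 : 0 ≤ t := Real.sqrt_nonneg _
  have htt : t * t = Q⁻¹ := Real.mul_self_sqrt hx0.le
  have ht1 : t ≤ 1 := by nlinarith
  have hxn0 : 0 ≤ Q⁻¹ ^ n := by positivity
  have hxn : Q⁻¹ ^ n ≤ 1 / 4 :=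
    (pow_le_pow_of_le_one hx0.le (by linarith) hn).trans (by nlinarith)
  have he : e ≤ Q⁻¹ ^ n * (Q⁻¹ / (1 - Q⁻¹)) := by
    refine (mul_le_mul_of_nonneg_left hL (by positivity)).trans (le_of_eq ?_)
    rw [← mul_assoc, ← pow_add, Nat.add_sub_cancel' (by lia)]
  have hbound {a : ℝ} (ha : Q⁻¹ ≤ a * (1 - Q⁻¹)) : e ≤ Q⁻¹ ^ n * a :=
    he.trans (mul_le_mul_of_nonneg_left ((div_le_iff₀ (by linarith)).mpr ha) hxn0)
  refine ⟨mul_nonneg (by positivity) (by linarith), ?_, ?_, by positivity, ?_, fun hQ3 => ?_⟩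
  · linarith [hbound (a := 1) (by linarith)]
  · have := hbound (a := 2 * t) (by nlinarith)
    change e ≤ 2 * (Q⁻¹ ^ n * t)
    linarith
  · change Q⁻¹ ^ n * t ≤ 1 / 2
    nlinarith
  · refine hbound ?_
    have hx3 : Q⁻¹ ≤ 1 / 3 := by rw [inv_le_comm₀ (by linarith) (by norm_num)]; linarith
    have ht : t ≤ 2 / 3 := by nlinarith
    nlinarith

theorem rpow_neg_natCast_mul_eq {q : ℝ} (hq : 0 < q) (k d : ℕ) :
    q ^ (-((k : ℝ) * d)) = (q ^ d)⁻¹ ^ k := by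
  rw [Real.rpow_neg hq.le, ← Nat.cast_mul, Real.rpow_natCast, inv_pow, ← pow_mul, mul_comm]

theorem rpow_neg_add_half_mul_eq {q : ℝ} (hq : 0 < q) (n d : ℕ) :
    q ^ (-(((n : ℝ) + 1 / 2) * d)) = (q ^ d)⁻¹ ^ n * √(q ^ d)⁻¹ := by
  have hsqrt : √(q ^ d)⁻¹ = q ^ (-(1 / 2 * (d : ℝ))) := by
    rw [Real.sqrt_eq_rpow, ← Real.rpow_natCast, ← Real.rpow_neg hq.le, ← Real.rpow_mul hq.le]
    ring_nf
  rw [hsqrt, ← rpow_neg_natCast_mul_eq hq, ← Real.rpow_add hq]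
  ring_nf

/-- Proposition 3.2.  Let `X = V(I) ∖ V(J) ⊂ ℙ^r_{F_q}` be a smooth
quasi-projective subscheme of dimension `n`, and `1 ≤ k ≤ n − 1`.  If `q ≥ 3` then
`ζ_X(n + 1/2)⁻¹ ≤ ∏_{x ∈ X closed} (1 − q^{−k·deg x} + q^{−k·deg x}·L(q^{deg x}, n, k))`,
and if `q = 2` the same holds after multiplying the left side by `2^{−#X(F_2)}`. -/
theorem euler_product_lower_bound
    (q r n k : ℕ) (Fq : Type) [Field Fq] [Fintype Fq]
    (hcard : Fintype.card Fq = q)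
    (hk1 : 1 ≤ k) (hk2 : k ≤ n - 1)
    (I J : Ideal (PolyRing Fq r))
    (hIhom : I.IsHomogeneous (MvPolynomial.homogeneousSubmodule (Fin (r + 1)) Fq))
    (hJhom : J.IsHomogeneous (MvPolynomial.homogeneousSubmodule (Fin (r + 1)) Fq))
    (hsmooth : SmoothOfDim Fq r I J n)
    (hdim : ringKrullDim (PolyRing Fq r ⧸ I) = (n + 1 : ℕ)) :
    (3 ≤ q →
      (zetaValue q Fq r (zeroSet Fq r I \ zeroSet Fq r J) ((n : ℝ) + 1 / 2))⁻¹ ≤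
        ∏' c : ClosedPoint q Fq r (zeroSet Fq r I \ zeroSet Fq r J),
          (1 - (q : ℝ) ^ (-((k : ℝ) * (cpDegree q Fq r c : ℝ))) +
            (q : ℝ) ^ (-((k : ℝ) * (cpDegree q Fq r c : ℝ))) *
              LinIndepProb ((q : ℝ) ^ (cpDegree q Fq r c : ℕ)) n k)) ∧
    (q = 2 →
      (2 : ℝ) ^ (-(rationalPointCount q Fq r (zeroSet Fq r I \ zeroSet Fq r J) : ℝ)) *
          (zetaValue q Fq r (zeroSet Fq r I \ zeroSet Fq r J) ((n : ℝ) + 1 / 2))⁻¹ ≤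
        ∏' c : ClosedPoint q Fq r (zeroSet Fq r I \ zeroSet Fq r J),
          (1 - (q : ℝ) ^ (-((k : ℝ) * (cpDegree q Fq r c : ℝ))) +
            (q : ℝ) ^ (-((k : ℝ) * (cpDegree q Fq r c : ℝ))) *
              LinIndepProb ((q : ℝ) ^ (cpDegree q Fq r c : ℕ)) n k)) := by
  subst hcard
  set X := zeroSet Fq r I \ zeroSet Fq r J
  set q := Fintype.card Fq
  have hq2 : (2 : ℝ) ≤ q := mod_cast Fintype.one_lt_card (α := Fq)
  have hq0 : (0 : ℝ) < q := by linarith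
  have hX : Set.MapsTo (frobP q Fq r) X X := fun P hP =>
    ⟨(frobP_mem_zeroSet_iff hIhom P).mpr hP.1, fun h => hP.2 ((frobP_mem_zeroSet_iff hJhom P).mp h)⟩
  obtain ⟨C, hC⟩ := exists_ncard_fixed_le hIhom hdim.le
  have hCX (d : ℕ) (hd : 1 ≤ d) : {P ∈ X | (frobP q Fq r)^[d] P = P}.Finite ∧
      {P ∈ X | (frobP q Fq r)^[d] P = P}.ncard ≤ C * (q ^ d) ^ n := by
    have hsub : {P ∈ X | (frobP q Fq r)^[d] P = P} ⊆
        {P ∈ zeroSet Fq r I | (frobP q Fq r)^[d] P = P} := fun P hP => ⟨hP.1.1, hP.2⟩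
    exact ⟨(hC d hd).1.subset hsub, (Set.ncard_le_ncard hsub (hC d hd).1).trans (hC d hd).2⟩
  have hfiber := finite_cpDegree_eq_and_ncard_le hX hCX
  have hdeg (c : ClosedPoint q Fq r X) : 1 ≤ cpDegree q Fq r c := (iterate_cpDegree_out hX c).1
  let Q (c : ClosedPoint q Fq r X) : ℝ := q ^ cpDegree q Fq r c
  let z (c : ClosedPoint q Fq r X) : ℝ := (Q c)⁻¹ ^ n * √(Q c)⁻¹
  let e (c : ClosedPoint q Fq r X) : ℝ := (Q c)⁻¹ ^ k * (1 - LinIndepProb (Q c) n k)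
  have hzeta : zetaValue q Fq r X ((n : ℝ) + 1 / 2) = ∏' c, (1 - z c)⁻¹ :=
    tprod_congr fun c => by rw [rpow_neg_add_half_mul_eq hq0]
  have hfactor (c : ClosedPoint q Fq r X) :
      1 - (q : ℝ) ^ (-((k : ℝ) * (cpDegree q Fq r c : ℝ))) +
        (q : ℝ) ^ (-((k : ℝ) * (cpDegree q Fq r c : ℝ))) *
          LinIndepProb ((q : ℝ) ^ (cpDegree q Fq r c : ℕ)) n k = 1 - e c := by
    rw [rpow_neg_natCast_mul_eq hq0]
    ring
  simp only [hzeta, hfactor]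
  have hsum : Summable z := by
    refine summable_comp_of_ncard_fiber (deg := cpDegree q Fq r)
      (g := fun d => ((q : ℝ) ^ d)⁻¹ ^ n * √((q : ℝ) ^ d)⁻¹) (fun d => by positivity)
      (fun d => (hfiber d).1) ?_
    have hlt : √(q : ℝ)⁻¹ < 1 := by
      rw [Real.sqrt_lt' one_pos, one_pow]
      exact inv_lt_one_of_one_lt₀ (by linarith)
    refine .of_nonneg_of_le (fun d => by positivity) (fun d => ?_)
      ((summable_geometric_of_lt_one (Real.sqrt_nonneg _) hlt).mul_left (C : ℝ))
    have hle : ({c | cpDegree q Fq r c = d}.ncard : ℝ) ≤ C * ((q : ℝ) ^ d) ^ n :=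
      mod_cast (hfiber d).2.2
    refine (mul_le_mul_of_nonneg_right hle (by positivity)).trans (le_of_eq ?_)
    have hsqrt : √((q : ℝ) ^ d)⁻¹ = √(q : ℝ)⁻¹ ^ d := by
      rw [← inv_pow, Real.sqrt_eq_iff_mul_self_eq (by positivity) (by positivity), ← mul_pow,
        Real.mul_self_sqrt (by positivity)]
    rw [hsqrt, inv_pow]
    field_simp
  have hQ (c : ClosedPoint q Fq r X) : 2 ≤ Q c :=
    hq2.trans (le_self_pow₀ (by linarith) (by have := hdeg c; lia))
  have hbounds (c : ClosedPoint q Fq r X) :=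
    local_factor_bounds (hQ c) (by lia : k + 1 ≤ n) (by lia : 2 ≤ n)
  have hcompare := pow_card_mul_inv_tprod_le_tprod hsum (fun c => (hbounds c).2.2.2.1)
    (fun c => (hbounds c).2.2.2.2.1) (fun c => (hbounds c).1) (fun c => (hbounds c).2.2.1)
  refine ⟨fun hq3 => ?_, fun hq => ?_⟩
  · have hQ3 (c : ClosedPoint q Fq r X) : 3 ≤ Q c :=
      (mod_cast hq3 : (3 : ℝ) ≤ q).trans (le_self_pow₀ (by linarith) (by have := hdeg c; lia))
    have := hcompare ∅ (by simp) fun c _ => (hbounds c).2.2.2.2.2 (hQ3 c)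
    rwa [Finset.card_empty, pow_zero, one_mul] at this
  · have hcount : (hfiber 1).1.toFinset.card ≤ rationalPointCount q Fq r X := by
      rw [← Set.ncard_eq_toFinset_card _ (hfiber 1).1]
      refine (hfiber 1).2.1.trans_eq (Nat.card_congr ?_)
      exact (Equiv.subtypeSubtypeEquivSubtypeInter (· ∈ X) (fun P => frobP q Fq r P = P)).symm
    refine le_trans (mul_le_mul_of_nonneg_right ?_ ?_)
      (hcompare (hfiber 1).1.toFinset (fun c _ => (hbounds c).2.1) fun c hc => ?_)
    · rw [Real.rpow_neg two_pos.le, Real.rpow_natCast, ← inv_pow, ← one_div]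
      exact pow_le_pow_of_le_one (by norm_num) (by norm_num) hcount
    · refine inv_nonneg.mpr (tprod_nonneg fun c => inv_nonneg.mpr ?_)
      linarith [(hbounds c).2.2.2.2.1]
    · refine (hbounds c).2.2.2.2.2 ?_
      have hd : 2 ≤ cpDegree q Fq r c := by
        have := hdeg c
        have : cpDegree q Fq r c ≠ 1 := fun h => hc ((hfiber 1).1.mem_toFinset.mpr h)
        lia
      calc (3 : ℝ) ≤ (q : ℝ) ^ 2 := by nlinarith
        _ ≤ Q c := pow_le_pow_right₀ (by linarith) hd
end
end

section
/- If C ⊂ P^r_k is a geometrically connected, reduced curve over a field k, then its arithmetic genus satisfies p_a(C) ≤ deg(C)·(deg(C) + 1) − 2. -/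
open MvPolynomial

attribute [local instance] MvPolynomial.gradedAlgebra

noncomputable section

/-- The degree-`d` graded piece of `k[x_0, …, x_r]/I`. -/
def quotGradedPiece (k : Type) [Field k] (r : ℕ)
    (I : Ideal (MvPolynomial (Fin (r + 1)) k)) (d : ℕ) :
    Submodule k (MvPolynomial (Fin (r + 1)) k ⧸ I) :=
  (MvPolynomial.homogeneousSubmodule (Fin (r + 1)) k d).map
    (Ideal.Quotient.mkₐ k I).toLinearMap

/-- The Hilbert function `d ↦ dim_k (k[x_0, …, x_r]/I)_d`. -/
def hilbertFunction (k : Type) [Field k] (r : ℕ)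
    (I : Ideal (MvPolynomial (Fin (r + 1)) k)) (d : ℕ) : ℕ :=
  Module.finrank k (quotGradedPiece k r I d)

/-- The extension of a homogeneous ideal `I ⊆ k[x_0, …, x_r]` to the polynomial ring over an
algebraic closure of `k`. -/
def idealBaseChange (k : Type) [Field k] (r : ℕ)
    (I : Ideal (MvPolynomial (Fin (r + 1)) k)) :
    Ideal (MvPolynomial (Fin (r + 1)) (AlgebraicClosure k)) :=
  I.map (MvPolynomial.map (algebraMap k (AlgebraicClosure k)))

/-- The target of an integral ring homomorphism has at most the Krull dimension of its source. -/
theorem ringKrullDim_le_of_isIntegral {A B : Type*} [CommRing A] [CommRing B] (f : A →+* B)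
    (hf : f.IsIntegral) : ringKrullDim B ≤ ringKrullDim A := by
  algebraize [f]
  have : Algebra.IsIntegral A B := ⟨hf⟩
  refine Order.krullDim_le_of_strictMono (PrimeSpectrum.comap f) fun x y hxy ↦ ?_
  have h : x.asIdeal < y.asIdeal := hxy
  exact Ideal.IsIntegral.comap_lt_comap (R := A) h

/-- A finitely generated algebra of dimension two over a field contains a polynomial ring in at
least two variables. -/
theorem exists_injective_mvPolynomial_of_ringKrullDim_eq_two (k A : Type*) [Field k] [CommRing A]
    [Nontrivial A] [Algebra k A] [Algebra.FiniteType k A] (hA : ringKrullDim A = 2) :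
    ∃ s, 2 ≤ s ∧ ∃ f : MvPolynomial (Fin s) k →ₐ[k] A, Function.Injective f := by
  obtain ⟨s, f, hf, hint⟩ := exists_integral_inj_algHom_of_fg k A
  refine ⟨s, ?_, f, hf⟩
  have h := ringKrullDim_le_of_isIntegral f.toRingHom hint
  rw [hA, MvPolynomial.ringKrullDim_of_isNoetherianRing, ringKrullDim_eq_zero_of_field] at h
  simp only [Nat.card_eq_fintype_card, Fintype.card_fin, zero_add] at h
  exact_mod_cast h

theorem finrank_finset_sup_le {k V ι : Type*} [Field k] [AddCommGroup V] [Module k V]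
    (s : Finset ι) (W : ι → Submodule k V) (hW : ∀ i, FiniteDimensional k (W i)) :
    FiniteDimensional k (s.sup W : Submodule k V) ∧
      Module.finrank k (s.sup W : Submodule k V) ≤ ∑ i ∈ s, Module.finrank k (W i) := by
  classical
  induction s using Finset.induction_on with
  | empty => simpa using inferInstanceAs (FiniteDimensional k (⊥ : Submodule k V))
  | insert i s hi ih =>
    obtain ⟨h1, h2⟩ := ih
    rw [Finset.sup_insert, Finset.sum_insert hi]
    exact ⟨inferInstance,
      (Submodule.finrank_add_le_finrank_add_finrank _ _).trans (Nat.add_le_add_left h2 _)⟩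

instance finiteDimensional_homogeneousSubmodule (k σ : Type*) [Field k] [Finite σ] (d : ℕ) :
    FiniteDimensional k (homogeneousSubmodule σ k d) :=
  Module.Finite.iff_fg.mpr (homogeneousSubmodule_fg σ k d)

instance finiteDimensional_quotGradedPiece (k : Type) [Field k] (r : ℕ)
    (I : Ideal (MvPolynomial (Fin (r + 1)) k)) (d : ℕ) :
    FiniteDimensional k (quotGradedPiece k r I d) := by
  unfold quotGradedPiece
  infer_instance

theorem mk_mem_sup_quotGradedPiece (k : Type) [Field k] (r : ℕ)
    (I : Ideal (MvPolynomial (Fin (r + 1)) k)) (n : ℕ) (f : MvPolynomial (Fin (r + 1)) k)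
    (hf : f.totalDegree ≤ n) :
    Ideal.Quotient.mkₐ k I f ∈ (Finset.range (n + 1)).sup (quotGradedPiece k r I) := by
  rw [← sum_homogeneousComponent f, map_sum]
  refine Submodule.sum_mem _ fun i hi ↦ ?_
  have h : quotGradedPiece k r I i ≤ (Finset.range (n + 1)).sup (quotGradedPiece k r I) := by
    refine Finset.le_sup (Finset.mem_range.mpr ?_)
    have := Finset.mem_range.mp hi
    omega
  exact h (Submodule.mem_map_of_mem (homogeneousComponent_mem i f))

/-- The monomials in two distinct variables are linearly independent. -/
theorem linearIndependent_pow_mul_pow (k : Type*) {σ : Type*} [Field k] {i j : σ} (hij : i ≠ j)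
    (n : ℕ) : LinearIndependent k fun ab : Fin n × Fin n ↦
      (X i ^ (ab.1 : ℕ) * X j ^ (ab.2 : ℕ) : MvPolynomial σ k) := by
  classical
  have h : LinearIndependent k fun m : σ →₀ ℕ ↦ (monomial m (1 : k)) := by
    simpa using (basisMonomials σ k).linearIndependent
  have hinj : Function.Injective fun ab : Fin n × Fin n ↦
      Finsupp.single i (ab.1 : ℕ) + Finsupp.single j (ab.2 : ℕ) := by
    intro a b hab
    have h0 := DFunLike.congr_fun hab i
    have h1 := DFunLike.congr_fun hab j
    simp only [Finsupp.add_apply, Finsupp.single_apply, if_neg hij, if_neg hij.symm, if_true,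
      add_zero, zero_add] at h0 h1
    exact Prod.ext (Fin.ext h0) (Fin.ext h1)
  convert h.comp _ hinj using 1
  funext ab
  simp [X_pow_eq_monomial, monomial_mul]

/-- If some prime over `I` has a quotient of dimension two, the Hilbert function is unbounded. -/
theorem hilbertFunction_unbounded (k : Type) [Field k] (r : ℕ)
    (I p : Ideal (MvPolynomial (Fin (r + 1)) k)) (hIp : I ≤ p) (hp : p ≠ ⊤)
    (hdim : ringKrullDim (MvPolynomial (Fin (r + 1)) k ⧸ p) = 2) (c : ℕ) :
    ∃ t, c < hilbertFunction k r I t := by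
  by_contra! hc
  have : Nontrivial (MvPolynomial (Fin (r + 1)) k ⧸ p) := Ideal.Quotient.nontrivial_iff.mpr hp
  obtain ⟨s, hs, f, hf⟩ := exists_injective_mvPolynomial_of_ringKrullDim_eq_two k _ hdim
  obtain ⟨y, hy⟩ := Ideal.Quotient.mkₐ_surjective k p (f (X ⟨0, by omega⟩))
  obtain ⟨z, hz⟩ := Ideal.Quotient.mkₐ_surjective k p (f (X ⟨1, by omega⟩))
  set e := y.totalDegree + z.totalDegree with he
  set n := c * (e + 1) + 1 with hn
  have hli : LinearIndependent k fun ab : Fin n × Fin n ↦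
      Ideal.Quotient.mkₐ k I (y ^ (ab.1 : ℕ) * z ^ (ab.2 : ℕ)) := by
    refine LinearIndependent.of_comp (Ideal.Quotient.factorₐ k hIp).toLinearMap ?_
    have h1 := (linearIndependent_pow_mul_pow k
      (show (⟨0, by omega⟩ : Fin s) ≠ ⟨1, by omega⟩ by simp) n).map' f.toLinearMap
      (LinearMap.ker_eq_bot.mpr hf)
    suffices h : (Ideal.Quotient.factorₐ k hIp).toLinearMap ∘ (fun ab : Fin n × Fin n ↦
        Ideal.Quotient.mkₐ k I (y ^ (ab.1 : ℕ) * z ^ (ab.2 : ℕ))) = f.toLinearMap ∘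
        fun ab : Fin n × Fin n ↦ X ⟨0, by omega⟩ ^ (ab.1 : ℕ) * X ⟨1, by omega⟩ ^ (ab.2 : ℕ) by
      rw [h]
      exact h1
    funext ab
    have hy' : Ideal.Quotient.mk p y = _ := hy
    have hz' : Ideal.Quotient.mk p z = _ := hz
    simp [hy', hz']
  obtain ⟨hfin, hle⟩ := finrank_finset_sup_le (Finset.range (n * e + 1)) (quotGradedPiece k r I)
    fun i ↦ inferInstance
  have hle' := Finset.sum_le_sum fun i (_ : i ∈ Finset.range (n * e + 1)) ↦ hc i
  rw [Finset.sum_const, Finset.card_range, smul_eq_mul] at hle'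
  have hmem : ∀ ab : Fin n × Fin n, Ideal.Quotient.mkₐ k I (y ^ (ab.1 : ℕ) * z ^ (ab.2 : ℕ)) ∈
      (Finset.range (n * e + 1)).sup (quotGradedPiece k r I) := by
    intro ab
    refine mk_mem_sup_quotGradedPiece k r I _ _ ?_
    refine (totalDegree_mul _ _).trans ?_
    have h1 := (totalDegree_pow y ab.1).trans (Nat.mul_le_mul_right _ ab.1.2.le)
    have h2 := (totalDegree_pow z ab.2).trans (Nat.mul_le_mul_right _ ab.2.2.le)
    rw [he, mul_add]
    exact Nat.add_le_add h1 h2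
  have hli' := LinearIndependent.of_comp (Submodule.subtype _)
    (v := fun ab ↦ (⟨_, hmem ab⟩ : ((Finset.range (n * e + 1)).sup (quotGradedPiece k r I) :
      Submodule k _))) hli
  have hcard := hli'.fintype_card_le_finrank
  simp only [Fintype.card_prod, Fintype.card_fin] at hcard
  have h3 : n * n ≤ (n * e + 1) * c := hcard.trans (hle.trans hle')
  nlinarith

/-- The degree-`d` graded piece of an ideal of the polynomial ring. -/
def idealGradedPiece (k : Type) [Field k] (r : ℕ)
    (I : Ideal (MvPolynomial (Fin (r + 1)) k)) (d : ℕ) :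
    Submodule k (MvPolynomial (Fin (r + 1)) k) :=
  I.restrictScalars k ⊓ homogeneousSubmodule (Fin (r + 1)) k d

theorem mem_idealGradedPiece {k : Type} [Field k] {r : ℕ}
    {I : Ideal (MvPolynomial (Fin (r + 1)) k)} {d : ℕ} {f : MvPolynomial (Fin (r + 1)) k} :
    f ∈ idealGradedPiece k r I d ↔ f ∈ I ∧ f.IsHomogeneous d := Iff.rfl

instance finiteDimensional_idealGradedPiece (k : Type) [Field k] (r : ℕ)
    (I : Ideal (MvPolynomial (Fin (r + 1)) k)) (d : ℕ) :
    FiniteDimensional k (idealGradedPiece k r I d) :=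
  Submodule.finiteDimensional_inf_right _ _

theorem hilbertFunction_add_finrank (k : Type) [Field k] (r : ℕ)
    (I : Ideal (MvPolynomial (Fin (r + 1)) k)) (d : ℕ) :
    hilbertFunction k r I d + Module.finrank k (idealGradedPiece k r I d) =
      Module.finrank k (homogeneousSubmodule (Fin (r + 1)) k d) := by
  have h := LinearMap.finrank_range_add_finrank_ker
    ((Ideal.Quotient.mkₐ k I).toLinearMap.domRestrict (homogeneousSubmodule (Fin (r + 1)) k d))
  rw [← h, LinearMap.range_domRestrict]
  congr 1
  rw [← Submodule.finrank_map_subtype_eq]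
  suffices h' : idealGradedPiece k r I d = Submodule.map
      (homogeneousSubmodule (Fin (r + 1)) k d).subtype (LinearMap.ker
        ((Ideal.Quotient.mkₐ k I).toLinearMap.domRestrict
          (homogeneousSubmodule (Fin (r + 1)) k d))) by rw [h']
  ext f
  simp only [mem_idealGradedPiece, Submodule.mem_map, LinearMap.mem_ker, Submodule.subtype_apply,
    LinearMap.domRestrict_apply, Subtype.exists, AlgHom.toLinearMap_apply]
  constructor
  · rintro ⟨h1, h2⟩
    exact ⟨f, h2, Ideal.Quotient.eq_zero_iff_mem.mpr h1, rfl⟩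
  · rintro ⟨_, h2, h1, rfl⟩
    exact ⟨Ideal.Quotient.eq_zero_iff_mem.mp h1, h2⟩

section BaseChange

variable {k K σ : Type*} [Field k] [Field K] [Algebra k K]

theorem linearIndependent_map_algebraMap {ι : Type*} [Finite ι] {v : ι → MvPolynomial σ k}
    (hv : LinearIndependent k v) :
    LinearIndependent K fun i ↦ MvPolynomial.map (algebraMap k K) (v i) := by
  have := Fintype.ofFinite ι
  rw [Fintype.linearIndependent_iff] at hv ⊢
  intro c hc i
  refine (Module.forall_dual_apply_eq_zero_iff k (c i)).mp fun φ ↦ ?_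
  refine hv (fun j ↦ φ (c j)) ?_ i
  ext m
  have h := congrArg φ (congrArg (coeff m) hc)
  simp only [coeff_sum, coeff_smul, coeff_map, smul_eq_mul, coeff_zero, map_zero, map_sum] at h ⊢
  rw [← h]
  refine Finset.sum_congr rfl fun j _ ↦ ?_
  rw [mul_comm (c j), ← Algebra.smul_def, map_smul, smul_eq_mul, mul_comm]

variable (K) in
theorem finrank_span_map_algebraMap (W : Submodule k (MvPolynomial σ k)) [FiniteDimensional k W] :
    Module.finrank K (Submodule.span K
      (MvPolynomial.map (algebraMap k K) '' (W : Set (MvPolynomial σ k)))) =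
      Module.finrank k W := by
  let b := Module.finBasis k W
  have hb : LinearIndependent k fun i ↦ (b i : MvPolynomial σ k) :=
    b.linearIndependent.map' W.subtype W.ker_subtype
  have h := finrank_span_eq_card (linearIndependent_map_algebraMap (K := K) hb)
  rw [Fintype.card_fin] at h
  rw [← h]
  suffices h' : Submodule.span K (MvPolynomial.map (algebraMap k K) '' (W : Set (MvPolynomial σ k)))
      = Submodule.span K (Set.range fun i ↦ MvPolynomial.map (algebraMap k K) (b i)) by rw [h']
  refine le_antisymm (Submodule.span_le.mpr ?_) (Submodule.span_mono ?_)
  · rintro _ ⟨f, hf, rfl⟩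
    have hs := b.sum_repr ⟨f, hf⟩
    have hs' : ∑ i, b.repr ⟨f, hf⟩ i • (b i : MvPolynomial σ k) = f := by
      simpa only [map_sum, map_smul, Submodule.subtype_apply] using congrArg W.subtype hs
    rw [← hs', map_sum]
    refine Submodule.sum_mem _ fun i _ ↦ ?_
    rw [smul_eq_C_mul, map_mul, map_C, ← smul_eq_C_mul]
    exact Submodule.smul_mem _ _ (Submodule.subset_span ⟨i, rfl⟩)
  · rintro _ ⟨i, rfl⟩
    exact ⟨b i, (b i).2, rfl⟩

theorem mem_span_of_mem_ideal_map (I : Ideal (MvPolynomial σ k)) {f : MvPolynomial σ K}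
    (hf : f ∈ I.map (MvPolynomial.map (algebraMap k K))) :
    f ∈ Submodule.span K (MvPolynomial.map (algebraMap k K) '' (I : Set (MvPolynomial σ k))) := by
  unfold Ideal.map Ideal.span at hf
  induction hf using Submodule.span_induction with
  | mem x hx => exact Submodule.subset_span hx
  | zero => exact Submodule.zero_mem _
  | add x y _ _ hx hy => exact Submodule.add_mem _ hx hy
  | smul a x hx' hx =>
    clear hx'
    rw [smul_eq_mul]
    induction hx using Submodule.span_induction with
    | zero => simp
    | add x y _ _ hx hy => rw [mul_add]; exact Submodule.add_mem _ hx hy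
    | smul c x _ hx => rw [Algebra.mul_smul_comm]; exact Submodule.smul_mem _ c hx
    | mem x hx =>
      obtain ⟨g, hg, rfl⟩ := hx
      induction a using MvPolynomial.induction_on' with
      | add p q hp hq => rw [add_mul]; exact Submodule.add_mem _ hp hq
      | monomial m c =>
        have h : monomial m c * MvPolynomial.map (algebraMap k K) g =
            c • MvPolynomial.map (algebraMap k K) (monomial m 1 * g) := by
          rw [map_mul, map_monomial, map_one, ← smul_mul_assoc, smul_monomial,
            smul_eq_mul, mul_one]
        rw [h]
        exact Submodule.smul_mem _ c (Submodule.subset_span ⟨_, I.mul_mem_left _ hg, rfl⟩)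

end BaseChange

theorem homogeneousComponent_map {k K σ : Type*} [Field k] [Field K] (f : k →+* K) (d : ℕ)
    (p : MvPolynomial σ k) :
    homogeneousComponent d (MvPolynomial.map f p) =
      MvPolynomial.map f (homogeneousComponent d p) := by
  classical
  ext m
  simp only [coeff_homogeneousComponent, coeff_map]
  split_ifs <;> simp

theorem idealGradedPiece_idealBaseChange (k : Type) [Field k] (r : ℕ)
    (I : Ideal (MvPolynomial (Fin (r + 1)) k))
    (hI : I.IsHomogeneous (homogeneousSubmodule (Fin (r + 1)) k)) (d : ℕ) :
    idealGradedPiece (AlgebraicClosure k) r (idealBaseChange k r I) d =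
      Submodule.span (AlgebraicClosure k) (MvPolynomial.map (algebraMap k (AlgebraicClosure k)) ''
        (idealGradedPiece k r I d : Set _)) := by
  refine le_antisymm ?_ (Submodule.span_le.mpr ?_)
  · rintro f ⟨hf, hfd⟩
    have h := mem_span_of_mem_ideal_map I hf
    rw [← homogeneousComponent_eq_self hfd]
    clear hf hfd
    induction h using Submodule.span_induction with
    | zero => simp
    | add x y _ _ hx hy => rw [map_add]; exact Submodule.add_mem _ hx hy
    | smul c x _ hx => rw [map_smul]; exact Submodule.smul_mem _ c hx
    | mem x hx =>
      obtain ⟨g, hg, rfl⟩ := hx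
      rw [homogeneousComponent_map]
      exact Submodule.subset_span ⟨_, ⟨homogeneousComponent_mem_of_mem hI hg d,
        homogeneousComponent_isHomogeneous d g⟩, rfl⟩
  · rintro _ ⟨g, ⟨hg, hgd⟩, rfl⟩
    exact ⟨Ideal.mem_map_of_mem _ hg, hgd.map _⟩

theorem idealGradedPiece_top (k : Type) [Field k] (r d : ℕ) :
    idealGradedPiece k r ⊤ d = homogeneousSubmodule (Fin (r + 1)) k d := by
  ext f
  simp [mem_idealGradedPiece]

/-- The Hilbert function is invariant under extension of the base field. -/
theorem hilbertFunction_idealBaseChange (k : Type) [Field k] (r : ℕ)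
    (I : Ideal (MvPolynomial (Fin (r + 1)) k))
    (hI : I.IsHomogeneous (homogeneousSubmodule (Fin (r + 1)) k)) (d : ℕ) :
    hilbertFunction (AlgebraicClosure k) r (idealBaseChange k r I) d = hilbertFunction k r I d := by
  have h1 := hilbertFunction_add_finrank k r I d
  have h2 := hilbertFunction_add_finrank (AlgebraicClosure k) r (idealBaseChange k r I) d
  have h3 := idealGradedPiece_idealBaseChange k r ⊤ (Ideal.IsHomogeneous.top _) d
  rw [idealBaseChange, Ideal.map_top, idealGradedPiece_top, idealGradedPiece_top] at h3
  rw [idealGradedPiece_idealBaseChange k r I hI, finrank_span_map_algebraMap, h3,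
    finrank_span_map_algebraMap] at h2
  omega

theorem isHomogeneous_of_forall_homogeneousComponent_mem {k σ : Type*} [Field k]
    {I : Ideal (MvPolynomial σ k)}
    (h : ∀ f ∈ I, ∀ d, homogeneousComponent d f ∈ I) :
    I.IsHomogeneous (homogeneousSubmodule σ k) := by
  intro d f hf
  have : ((DirectSum.decompose (homogeneousSubmodule σ k) f) d : MvPolynomial σ k) =
    homogeneousComponent d f := decomposition.decompose'_apply f d
  rw [this]
  exact h f hf d

theorem isHomogeneous_idealBaseChange (k : Type) [Field k] (r : ℕ)
    (I : Ideal (MvPolynomial (Fin (r + 1)) k))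
    (hI : I.IsHomogeneous (homogeneousSubmodule (Fin (r + 1)) k)) :
    (idealBaseChange k r I).IsHomogeneous
      (homogeneousSubmodule (Fin (r + 1)) (AlgebraicClosure k)) := by
  refine isHomogeneous_of_forall_homogeneousComponent_mem fun f hf d ↦ ?_
  have h := mem_span_of_mem_ideal_map I hf
  clear hf
  induction h using Submodule.span_induction with
  | zero => simp
  | add x y _ _ hx hy => rw [map_add]; exact Ideal.add_mem _ hx hy
  | smul c x _ hx =>
    rw [map_smul, smul_eq_C_mul]
    exact Ideal.mul_mem_left _ _ hx
  | mem x hx =>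
    obtain ⟨g, hg, rfl⟩ := hx
    rw [homogeneousComponent_map]
    exact Ideal.mem_map_of_mem _ (homogeneousComponent_mem_of_mem hI hg d)

/-- Over an infinite field, every ideal `J` of a polynomial ring agrees, up to a power of the
irrelevant ideal, with an ideal `J'` modulo which some linear form is a nonzerodivisor. -/
theorem exists_linearForm_regular (k σ : Type*) [Field k] [Infinite k] [Finite σ]
    (J : Ideal (MvPolynomial σ k)) :
    ∃ (l : MvPolynomial σ k) (J' : Ideal (MvPolynomial σ k)) (N : ℕ), l.IsHomogeneous 1 ∧ J ≤ J' ∧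
      (∀ f, l * f ∈ J' → f ∈ J') ∧ Ideal.span (Set.range X) ^ N ⊓ J' ≤ J := by
  classical
  set m : Ideal (MvPolynomial σ k) := Ideal.span (Set.range X) with hm
  obtain ⟨s, hs, hprim⟩ := Submodule.isLasker (MvPolynomial σ k) (MvPolynomial σ k) J
  set s1 := s.filter fun q : Ideal (MvPolynomial σ k) ↦ ¬ m ≤ Ideal.radical q with hs1
  have hJ : ∀ f, f ∈ J ↔ ∀ q ∈ s, f ∈ q := by
    intro f
    rw [← hs, Submodule.mem_finsetInf]
    rfl
  have hl : ∃ l : homogeneousSubmodule σ k 1, ∀ q ∈ s1,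
      (l : MvPolynomial σ k) ∉ Ideal.radical q := by
    let W : Ideal (MvPolynomial σ k) → Submodule k (homogeneousSubmodule σ k 1) := fun q ↦
      (q.radical.restrictScalars k).comap (homogeneousSubmodule σ k 1).subtype
    have h := Subspace.biUnion_ne_univ_of_top_notMem (s := s1.image W) (by
      intro htop
      obtain ⟨q, hq, hqW⟩ := Finset.mem_image.mp htop
      refine (Finset.mem_filter.mp hq).2 (Ideal.span_le.mpr ?_)
      rintro _ ⟨i, rfl⟩
      have : (⟨X i, isHomogeneous_X k i⟩ : homogeneousSubmodule σ k 1) ∈ W q := by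
        rw [hqW]
        trivial
      exact this)
    obtain ⟨l, hl⟩ := (Set.ne_univ_iff_exists_notMem _).mp h
    refine ⟨l, fun q hq hlq ↦ hl ?_⟩
    exact Set.mem_biUnion (Finset.mem_coe.mpr (Finset.mem_image_of_mem W hq)) hlq
  obtain ⟨⟨l, hl1⟩, hl⟩ := hl
  have hpow : ∀ q : Ideal (MvPolynomial σ k), ∃ n, m ≤ Ideal.radical q → m ^ n ≤ q := by
    intro q
    by_cases h : m ≤ Ideal.radical q
    · obtain ⟨n, hn⟩ := Ideal.exists_pow_le_of_le_radical_of_fg h (IsNoetherian.noetherian m)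
      exact ⟨n, fun _ ↦ hn⟩
    · exact ⟨0, fun h' ↦ absurd h' h⟩
  choose n hn using hpow
  refine ⟨l, s1.inf id, s.sup n, hl1, ?_, fun f hf ↦ ?_, ?_⟩
  · rw [← hs]
    exact Finset.inf_mono (Finset.filter_subset _ _)
  · rw [Submodule.mem_finsetInf] at hf ⊢
    intro q hq
    have h := (Ideal.isPrimary_iff.mp (hprim (Finset.mem_filter.mp hq).1)).2
      (x := f) (y := l) (by rw [mul_comm]; exact hf q hq)
    exact h.resolve_right (hl q hq)
  · rintro f ⟨hf1, hf2⟩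
    refine (hJ f).mpr fun q hq ↦ ?_
    by_cases h : m ≤ Ideal.radical q
    · exact hn q h (Ideal.pow_le_pow_right (Finset.le_sup hq) hf1)
    · exact Submodule.mem_finsetInf.mp hf2 q (Finset.mem_filter.mpr ⟨hq, h⟩)

theorem homogeneousSubmodule_le_irrelevant_pow (k σ : Type*) [Field k] {d N : ℕ} (h : N ≤ d)
    {f : MvPolynomial σ k} (hf : f.IsHomogeneous d) :
    f ∈ (Ideal.span (Set.range X) : Ideal (MvPolynomial σ k)) ^ N := by
  refine Ideal.pow_le_pow_right h ?_
  rw [Ideal.mem_span_pow_iff_exists_isHomogeneous]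
  refine ⟨MvPolynomial.map C f, hf.map _, ?_⟩
  simp [eval_map]

theorem homogeneousComponent_add_mul {k σ : Type*} [Field k] {g : MvPolynomial σ k} {e : ℕ}
    (hg : g.IsHomogeneous e) (f : MvPolynomial σ k) (d : ℕ) :
    homogeneousComponent (d + e) (g * f) = g * homogeneousComponent d f := by
  conv_lhs => rw [← sum_homogeneousComponent f, Finset.mul_sum, map_sum]
  have h : ∀ i, homogeneousComponent (d + e) (g * homogeneousComponent i f) =
      if i = d then g * homogeneousComponent d f else 0 := by
    intro i
    rw [homogeneousComponent_of_mem (hg.mul (homogeneousComponent_isHomogeneous i f))]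
    by_cases hi : i = d
    · subst hi
      simp [add_comm]
    · rw [if_neg hi, if_neg (by omega)]
  simp only [h, Finset.sum_ite_eq', Finset.mem_range]
  split_ifs with hd
  · rfl
  · rw [homogeneousComponent_eq_zero _ _ (by omega), mul_zero]

/-- A homogeneous refinement of `exists_linearForm_regular`. -/
theorem exists_linearForm_regular_homogeneous (k σ : Type*) [Field k] [Infinite k] [Finite σ]
    (J : Ideal (MvPolynomial σ k)) (hJ : J.IsHomogeneous (homogeneousSubmodule σ k)) :
    ∃ (l : MvPolynomial σ k) (J' : Ideal (MvPolynomial σ k)) (N : ℕ), l.IsHomogeneous 1 ∧ J ≤ J' ∧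
      (∀ f, l * f ∈ J' → f ∈ J') ∧ Ideal.span (Set.range X) ^ N ⊓ J' ≤ J ∧
      J'.IsHomogeneous (homogeneousSubmodule σ k) := by
  obtain ⟨l, J', N, hl, hle, hreg, hN⟩ := exists_linearForm_regular k σ J
  refine ⟨l, J', N, hl, hle, hreg, hN, isHomogeneous_of_forall_homogeneousComponent_mem ?_⟩
  have hlN : (l ^ N).IsHomogeneous N := by simpa using hl.pow N
  have hpow : ∀ n f, l ^ n * f ∈ J' → f ∈ J' := by
    intro n
    induction n with
    | zero => simp
    | succ n ih =>
      intro f hf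
      rw [pow_succ', mul_assoc] at hf
      exact ih f (hreg _ hf)
  intro f hf d
  have h1 : l ^ N * f ∈ J := hN ⟨Ideal.mul_mem_right _ _
    (homogeneousSubmodule_le_irrelevant_pow k σ le_rfl hlN), J'.mul_mem_left _ hf⟩
  have h2 := homogeneousComponent_mem_of_mem hJ h1 (d + N)
  rw [homogeneousComponent_add_mul hlN] at h2
  exact hpow N _ (hle h2)

theorem hilbertFunction_anti {k : Type} [Field k] {r : ℕ}
    {I J : Ideal (MvPolynomial (Fin (r + 1)) k)} {d : ℕ}
    (h : idealGradedPiece k r I d ≤ idealGradedPiece k r J d) :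
    hilbertFunction k r J d ≤ hilbertFunction k r I d := by
  have h1 := hilbertFunction_add_finrank k r I d
  have h2 := hilbertFunction_add_finrank k r J d
  have h3 := Submodule.finrank_mono h
  omega

theorem hilbertFunction_eq_zero_iff {k : Type} [Field k] {r : ℕ}
    {I : Ideal (MvPolynomial (Fin (r + 1)) k)} {d : ℕ} :
    hilbertFunction k r I d = 0 ↔
      ∀ f : MvPolynomial (Fin (r + 1)) k, f.IsHomogeneous d → f ∈ I := by
  have h1 := hilbertFunction_add_finrank k r I d
  have hle : idealGradedPiece k r I d ≤ homogeneousSubmodule (Fin (r + 1)) k d := inf_le_right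
  constructor
  · intro h f hf
    have h2 := Submodule.eq_of_le_of_finrank_eq hle (by omega)
    have hf' : f ∈ homogeneousSubmodule (Fin (r + 1)) k d := hf
    rw [← h2] at hf'
    exact hf'.1
  · intro h
    have h2 : idealGradedPiece k r I d = homogeneousSubmodule (Fin (r + 1)) k d :=
      le_antisymm hle fun f hf ↦ ⟨h f hf, hf⟩
    rw [h2] at h1
    omega

theorem hilbertFunction_zero_pos {k : Type} [Field k] {r : ℕ}
    {I : Ideal (MvPolynomial (Fin (r + 1)) k)} (hI : I ≠ ⊤) : 0 < hilbertFunction k r I 0 := by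
  rw [Nat.pos_iff_ne_zero]
  intro h
  exact hI ((Ideal.eq_top_iff_one I).mpr
    (hilbertFunction_eq_zero_iff.mp h 1 (isHomogeneous_one _ _)))

theorem hilbertFunction_succ_eq_zero {k : Type} [Field k] {r : ℕ}
    {I : Ideal (MvPolynomial (Fin (r + 1)) k)} {d : ℕ} (h : hilbertFunction k r I d = 0) :
    hilbertFunction k r I (d + 1) = 0 := by
  rw [hilbertFunction_eq_zero_iff] at h ⊢
  intro f hf
  have hf' : f ∈ homogeneousSubmodule (Fin (r + 1)) k (d + 1) := hf
  rw [← homogeneousSubmodule_one_pow, pow_succ, homogeneousSubmodule_one_pow] at hf'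
  have hle : homogeneousSubmodule (Fin (r + 1)) k d * homogeneousSubmodule (Fin (r + 1)) k 1 ≤
      I.restrictScalars k :=
    Submodule.mul_le.mpr fun a ha b _ ↦ I.mul_mem_right b (h a ha)
  exact hle hf'

/-- Cutting by a linear form which is a nonzerodivisor differentiates the Hilbert function. -/
theorem hilbertFunction_succ {k : Type} [Field k] {r : ℕ}
    {I : Ideal (MvPolynomial (Fin (r + 1)) k)}
    (hI : I.IsHomogeneous (homogeneousSubmodule (Fin (r + 1)) k))
    {l : MvPolynomial (Fin (r + 1)) k} (hl : l.IsHomogeneous 1) (hl0 : l ≠ 0)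
    (hreg : ∀ f, l * f ∈ I → f ∈ I) (d : ℕ) :
    hilbertFunction k r I (d + 1) =
      hilbertFunction k r I d + hilbertFunction k r (I ⊔ Ideal.span {l}) (d + 1) := by
  have hinj : Function.Injective (LinearMap.mulLeft k l) := mul_right_injective₀ hl0
  have hsup : idealGradedPiece k r (I ⊔ Ideal.span {l}) (d + 1) = idealGradedPiece k r I (d + 1) ⊔
      (homogeneousSubmodule (Fin (r + 1)) k d).map (LinearMap.mulLeft k l) := by
    refine le_antisymm ?_ (sup_le ?_ ?_)
    · rintro f ⟨hf, hfd⟩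
      obtain ⟨g, hg, h, hh, rfl⟩ := Submodule.mem_sup.mp hf
      obtain ⟨q, rfl⟩ := Ideal.mem_span_singleton.mp hh
      rw [← homogeneousComponent_eq_self hfd, map_add, homogeneousComponent_add_mul hl]
      exact Submodule.add_mem_sup
        ⟨homogeneousComponent_mem_of_mem hI hg _, homogeneousComponent_isHomogeneous _ _⟩
        ⟨_, homogeneousComponent_isHomogeneous d q, rfl⟩
    · exact fun f hf ↦ ⟨Ideal.mem_sup_left hf.1, hf.2⟩
    · rintro _ ⟨f, hf, rfl⟩
      refine ⟨Ideal.mem_sup_right (Ideal.mul_mem_right _ _ (Ideal.mem_span_singleton_self l)), ?_⟩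
      have h := hl.mul hf
      rwa [add_comm 1 d] at h
  have hinf : idealGradedPiece k r I (d + 1) ⊓
      (homogeneousSubmodule (Fin (r + 1)) k d).map (LinearMap.mulLeft k l) =
      (idealGradedPiece k r I d).map (LinearMap.mulLeft k l) := by
    refine le_antisymm ?_ (le_inf ?_ (Submodule.map_mono inf_le_right))
    · rintro _ ⟨⟨h1, _⟩, f, hf, rfl⟩
      exact ⟨f, ⟨hreg f h1, hf⟩, rfl⟩
    · rintro _ ⟨f, hf, rfl⟩
      have h := hl.mul hf.2
      rw [add_comm 1 d] at h
      exact ⟨I.mul_mem_left _ hf.1, h⟩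
  have h := Submodule.finrank_sup_add_finrank_inf_eq (idealGradedPiece k r I (d + 1))
      ((homogeneousSubmodule (Fin (r + 1)) k d).map (LinearMap.mulLeft k l))
  rw [← hsup, hinf, ← (Submodule.equivMapOfInjective _ hinj _).finrank_eq,
    ← (Submodule.equivMapOfInjective _ hinj _).finrank_eq] at h
  have h1 := hilbertFunction_add_finrank k r I d
  have h2 := hilbertFunction_add_finrank k r I (d + 1)
  have h3 := hilbertFunction_add_finrank k r (I ⊔ Ideal.span {l}) (d + 1)
  omega

/-- A radical homogeneous ideal with nonempty projective zero locus has a linear form which is a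
nonzerodivisor modulo it. -/
theorem exists_linearForm_regular_of_isRadical {k σ : Type*} [Field k] [Infinite k] [Finite σ]
    {J P : Ideal (MvPolynomial σ k)} (hrad : J.IsRadical) (hJP : J ≤ P) [hP : P.IsPrime]
    (hPh : P.IsHomogeneous (homogeneousSubmodule σ k)) {i : σ} (hi : X i ∉ P) :
    ∃ l : MvPolynomial σ k, l.IsHomogeneous 1 ∧ ∀ f, l * f ∈ J → f ∈ J := by
  obtain ⟨l, J', N, hl, hle, hreg, hN⟩ := exists_linearForm_regular k σ J
  suffices h : J' ≤ J from ⟨l, hl, fun f hf ↦ h (hreg f (hle hf))⟩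
  intro f hf
  have hX : ∀ j, X j * f ∈ J := by
    intro j
    have hpow : (X j * f) ^ (N + 1) ∈ J := by
      refine hN (Submodule.mem_inf.mpr ⟨?_, ?_⟩)
      · have hXj : (X j : MvPolynomial σ k) ^ N ∈ Ideal.span (Set.range X) ^ N :=
          Ideal.pow_mem_pow (Ideal.subset_span (Set.mem_range_self j)) N
        rw [mul_pow, pow_succ, mul_assoc]
        exact Ideal.mul_mem_right _ _ hXj
      · exact Ideal.pow_mem_of_mem _ (J'.mul_mem_left _ hf) _ N.succ_pos
    exact hrad (Ideal.mem_radical_iff.mpr ⟨N + 1, hpow⟩)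
  have hm : ∀ g ∈ (Ideal.span (Set.range X) : Ideal (MvPolynomial σ k)), g * f ∈ J := by
    intro g hg
    induction hg using Submodule.span_induction with
    | mem x hx => obtain ⟨j, rfl⟩ := hx; exact hX j
    | zero => simp
    | add x y _ _ hx hy => rw [add_mul]; exact J.add_mem hx hy
    | smul a x _ hx => rw [smul_eq_mul, mul_assoc]; exact J.mul_mem_left _ hx
  have hfP : f ∈ P := (hP.mem_or_mem (hJP (hX i))).resolve_left hi
  refine hrad (Ideal.mem_radical_iff.mpr ⟨2, ?_⟩)
  rw [pow_two]
  refine hm f ?_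
  rw [← sum_homogeneousComponent f]
  refine Ideal.sum_mem _ fun d _ ↦ ?_
  rcases Nat.eq_zero_or_pos d with rfl | hd
  · have h0 := homogeneousComponent_mem_of_mem hPh hfP 0
    rw [homogeneousComponent_zero] at h0 ⊢
    by_cases hc : coeff 0 f = 0
    · simp [hc]
    · exact absurd (Ideal.eq_top_of_isUnit_mem _ h0 ((IsUnit.mk0 _ hc).map C)) hP.ne_top
  · simpa using homogeneousSubmodule_le_irrelevant_pow k σ hd
      (homogeneousComponent_isHomogeneous d f)

/-- If a linear form is regular modulo an ideal, its Hilbert function grows at least as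
`min (t + 1) D` until it reaches its limit `D`. -/
theorem le_hilbertFunction_of_regular {k : Type} [Field k] {r : ℕ}
    {I : Ideal (MvPolynomial (Fin (r + 1)) k)}
    (hI : I.IsHomogeneous (homogeneousSubmodule (Fin (r + 1)) k))
    {l : MvPolynomial (Fin (r + 1)) k} (hl : l.IsHomogeneous 1)
    (hreg : ∀ f, l * f ∈ I → f ∈ I) {D N : ℕ} (hD : 1 ≤ D)
    (hN : ∀ t, N ≤ t → hilbertFunction k r I t = D) (t : ℕ) :
    hilbertFunction k r I t = D ∨ t + 1 ≤ hilbertFunction k r I t := by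
  have htop : I ≠ ⊤ := by
    rintro rfl
    have h : hilbertFunction k r ⊤ N = 0 := hilbertFunction_eq_zero_iff.mpr fun _ _ ↦ trivial
    have := hN N le_rfl
    omega
  have hl0 : l ≠ 0 := by
    rintro rfl
    exact htop ((Ideal.eq_top_iff_one I).mpr (hreg 1 (by simp)))
  have hsucc := hilbertFunction_succ hI hl hl0 hreg
  suffices h : (∀ u, t ≤ u → hilbertFunction k r I u = hilbertFunction k r I t) ∨
      t + 1 ≤ hilbertFunction k r I t by
    refine h.imp_left fun h ↦ ?_
    rw [← h (t + N) (by omega), hN (t + N) (by omega)]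
  induction t with
  | zero => exact Or.inr (hilbertFunction_zero_pos htop)
  | succ t ih =>
    rcases ih with h | h
    · refine Or.inl fun u hu ↦ ?_
      rw [h u (by omega), h (t + 1) (by omega)]
    · have hs := hsucc t
      by_cases hz : hilbertFunction k r (I ⊔ Ideal.span {l}) (t + 1) = 0
      · left
        have hz' : ∀ u, t + 1 ≤ u → hilbertFunction k r (I ⊔ Ideal.span {l}) u = 0 := by
          intro u hu
          induction u, hu using Nat.le_induction with
          | base => exact hz
          | succ u _ ih => exact hilbertFunction_succ_eq_zero ih
        intro u hu
        induction u, hu using Nat.le_induction with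
        | base => rfl
        | succ u hu ih => rw [hsucc u, hz' (u + 1) (by omega), ih, add_zero]
      · right
        omega

/-- Summing `min (t + 1) D` bounds a function from below by a linear one. -/
theorem linear_le_of_forall_min_le_sub {H h : ℕ → ℕ} {D : ℕ} (hD : 1 ≤ D) (h0 : 1 ≤ H 0)
    (hH : ∀ t, H (t + 1) = H t + h (t + 1)) (hh : ∀ t, D ≤ h t ∨ t + 1 ≤ h t) (t : ℕ) :
    (t + 1 ≤ D → (t + 1) * (t + 2) ≤ 2 * (H t : ℤ)) ∧
      (D ≤ t + 1 → 2 * D * (t + 1) - D * (D - 1) ≤ 2 * (H t : ℤ)) := by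
  induction t with
  | zero =>
    refine ⟨fun _ ↦ by push_cast; omega, fun hd ↦ ?_⟩
    obtain rfl : D = 1 := by omega
    push_cast
    omega
  | succ t ih =>
    have h1 := hH t
    have h2 := hh (t + 1)
    zify at h1 h2
    constructor
    · intro hd
      have h3 := ih.1 (by omega)
      have h4 : (t : ℤ) + 2 ≤ h (t + 1) := by omega
      push_cast
      rw [h1]
      linarith
    · intro hd
      rcases Nat.lt_or_ge (t + 1) D with h' | h'
      · have h3 := ih.1 (by omega)
        have h4 : (t : ℤ) + 2 ≤ h (t + 1) := by omega
        obtain rfl : D = t + 2 := by omega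
        push_cast at h3 ⊢
        rw [h1]
        linarith
      · have h3 := ih.2 h'
        have h4 : (D : ℤ) ≤ h (t + 1) := by omega
        push_cast
        rw [h1]
        linarith

/-- Castelnuovo's bound for plane curves, valid for any one-dimensional projective scheme whose
homogeneous ideal has a linear form regular modulo it. -/
theorem two_mul_genus_le {k : Type} [Field k] [Infinite k] {r : ℕ}
    {J : Ideal (MvPolynomial (Fin (r + 1)) k)}
    (hJ : J.IsHomogeneous (homogeneousSubmodule (Fin (r + 1)) k)) (htop : J ≠ ⊤)
    {l : MvPolynomial (Fin (r + 1)) k} (hl : l.IsHomogeneous 1)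
    (hreg : ∀ f, l * f ∈ J → f ∈ J) {D : ℕ} (hD : 1 ≤ D) {g : ℤ}
    (hhilb : ∀ᶠ t : ℕ in Filter.atTop, (hilbertFunction k r J t : ℤ) = D * t + 1 - g) :
    2 * g ≤ (D - 1) * (D - 2) := by
  obtain ⟨M, hM⟩ := Filter.eventually_atTop.mp hhilb
  have hl0 : l ≠ 0 := by
    rintro rfl
    exact htop ((Ideal.eq_top_iff_one J).mpr (hreg 1 (by simp)))
  have hsucc := hilbertFunction_succ hJ hl hl0 hreg
  have hJ1 : (J ⊔ Ideal.span {l}).IsHomogeneous (homogeneousSubmodule (Fin (r + 1)) k) := by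
    refine Ideal.IsHomogeneous.sup hJ (Ideal.homogeneous_span _ _ ?_)
    rintro _ rfl
    exact ⟨1, hl⟩
  set J1 := J ⊔ Ideal.span {l}
  obtain ⟨l', J', N, hl', hle, hreg', hN, hJ'⟩ := exists_linearForm_regular_homogeneous k _ J1 hJ1
  have hle' : ∀ t, hilbertFunction k r J' t ≤ hilbertFunction k r J1 t := fun t ↦
    hilbertFunction_anti fun f hf ↦ ⟨hle hf.1, hf.2⟩
  have heq : ∀ t, N + M + 1 ≤ t → hilbertFunction k r J' t = D := by
    intro t ht
    have h1 : hilbertFunction k r J1 t ≤ hilbertFunction k r J' t :=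
      hilbertFunction_anti fun f hf ↦
        ⟨hN ⟨homogeneousSubmodule_le_irrelevant_pow k _ (by omega) hf.2, hf.1⟩, hf.2⟩
    obtain ⟨u, rfl⟩ : ∃ u, t = u + 1 := ⟨t - 1, by omega⟩
    have h2 := hsucc u
    have h3 := hM u (by omega)
    have h4 := hM (u + 1) (by omega)
    have h5 := hle' (u + 1)
    zify at h1 h2 h5 ⊢
    push_cast at h4
    linarith
  have hmin := le_hilbertFunction_of_regular hJ' hl' hreg' hD heq
  have h := (linear_le_of_forall_min_le_sub hD (hilbertFunction_zero_pos htop) hsucc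
    (fun t ↦ (hmin t).imp (fun h ↦ h.symm.le.trans (hle' t)) fun h ↦ h.trans (hle' t)) (M + D)).2
      (by omega)
  rw [hM (M + D) (by omega)] at h
  push_cast at h
  linarith

/-- Let `C ⊂ ℙ^r_k` be the curve cut out by the saturated homogeneous ideal
`I` (so every associated prime of `k[x]/I` has Krull dimension `2`: `C` is equidimensional of
dimension one with no embedded components), which is geometrically reduced (the base change of
`k[x]/I` to an algebraic closure is reduced) and geometrically connected (the zero locus of `I`
in the projective spectrum over an algebraic closure is connected).  If the Hilbert polynomial
of `C` is `P_C(t) = D·t + 1 − g` (`D = deg C`, `g = p_a(C)`), then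
`p_a(C) ≤ deg(C)·(deg(C) + 1) − 2`. -/
theorem arithmeticGenus_le_of_geometricallyConnected_reduced_curve
    (k : Type) [Field k] (r : ℕ)
    (I : Ideal (MvPolynomial (Fin (r + 1)) k))
    (hI : I.IsHomogeneous (MvPolynomial.homogeneousSubmodule (Fin (r + 1)) k))
    (hcurve : ∀ p ∈ associatedPrimes (MvPolynomial (Fin (r + 1)) k)
      (MvPolynomial (Fin (r + 1)) k ⧸ I),
      ringKrullDim (MvPolynomial (Fin (r + 1)) k ⧸ p) = 2)
    (hred : IsReduced
      (MvPolynomial (Fin (r + 1)) (AlgebraicClosure k) ⧸ idealBaseChange k r I))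
    (hconn : IsConnected (ProjectiveSpectrum.zeroLocus
      (MvPolynomial.homogeneousSubmodule (Fin (r + 1)) (AlgebraicClosure k))
      ((idealBaseChange k r I : Ideal (MvPolynomial (Fin (r + 1)) (AlgebraicClosure k)))
        : Set (MvPolynomial (Fin (r + 1)) (AlgebraicClosure k)))))
    (D : ℕ) (g : ℤ)
    (hhilb : ∀ᶠ t : ℕ in Filter.atTop,
      (hilbertFunction k r I t : ℤ) = D * t + 1 - g) :
    g ≤ D * (D + 1) - 2 := by
  have hJ := isHomogeneous_idealBaseChange k r I hI
  have hrad : (idealBaseChange k r I).IsRadical :=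
    Ideal.isRadical_iff_quotient_reduced _ |>.mpr hred
  obtain ⟨x, hx⟩ := hconn.nonempty
  have hJP : idealBaseChange k r I ≤ x.asHomogeneousIdeal.toIdeal := hx
  have hP := x.isPrime
  obtain ⟨i, hi⟩ : ∃ i, X i ∉ x.asHomogeneousIdeal.toIdeal := by
    by_contra! hall
    refine x.not_irrelevant_le ?_
    refine HomogeneousIdeal.toIdeal_irrelevant_le _ |>.mpr fun d hd f hf ↦ ?_
    have h : f ∈ Ideal.span (Set.range X) ^ 1 := homogeneousSubmodule_le_irrelevant_pow _ _ hd hf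
    rw [pow_one] at h
    refine Ideal.span_le.mpr ?_ h
    rintro _ ⟨i, rfl⟩
    exact hall i
  have htop : idealBaseChange k r I ≠ ⊤ := fun h ↦ hP.ne_top (top_le_iff.mp (h ▸ hJP))
  have hItop : I ≠ ⊤ := by
    rintro rfl
    exact htop (Ideal.map_top _)
  have hD : 1 ≤ D := by
    by_contra! hD0
    obtain rfl : D = 0 := by omega
    have : Nontrivial (MvPolynomial (Fin (r + 1)) k ⧸ I) := Ideal.Quotient.nontrivial_iff.mpr hItop
    obtain ⟨p, hp⟩ := associatedPrimes.nonempty (MvPolynomial (Fin (r + 1)) k)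
      (MvPolynomial (Fin (r + 1)) k ⧸ I)
    have hIp : I ≤ p := by
      have h := IsAssociatedPrime.annihilator_le hp
      rwa [Submodule.annihilator_top, Ideal.annihilator_quotient] at h
    obtain ⟨M, hM⟩ := Filter.eventually_atTop.mp hhilb
    obtain ⟨t, ht⟩ := hilbertFunction_unbounded k r I p hIp hp.isPrime.ne_top (hcurve p hp)
      (∑ t ∈ Finset.range (M + 1), hilbertFunction k r I t)
    have hsum : ∀ u, u < M + 1 → hilbertFunction k r I u ≤
        ∑ t ∈ Finset.range (M + 1), hilbertFunction k r I t := fun u hu ↦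
      Finset.single_le_sum (f := fun t ↦ hilbertFunction k r I t) (fun _ _ ↦ Nat.zero_le _)
        (Finset.mem_range.mpr hu)
    rcases Nat.lt_or_ge t (M + 1) with h | h
    · have := hsum t h
      omega
    · have h1 := hM t (by omega)
      have h2 := hM M le_rfl
      have h3 := hsum M (by omega)
      simp only [Nat.cast_zero, zero_mul] at h1 h2
      omega
  obtain ⟨l, hl, hreg⟩ := exists_linearForm_regular_of_isRadical hrad hJP
    x.asHomogeneousIdeal.isHomogeneous hi
  have h := two_mul_genus_le hJ htop hl hreg hD (g := g) (by
    simpa only [hilbertFunction_idealBaseChange k r I hI] using hhilb)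
  have hD' : (1 : ℤ) ≤ D := by exact_mod_cast hD
  nlinarith
end
end
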